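/- arXiv:1602.02016 — 5 statements merged into one kernel-verified Lean document; each statement's English description precedes it below -/
import Mathlib

section
/- Assume Schanuel's Conjecture. Let n ≥ 2 and let p₁,…,pₙ ∈ ℚ^alg[x₁,…,xₙ] be nonconstant polynomials. Then the system e^{x₁} = p₁(x), …, e^{xₙ} = pₙ(x) has a solution a ∈ ℂⁿ with td_ℚ(a₁,…,aₙ) ≥ 2. In particular, for n = 2 the system has a solution (a₁,a₂) with a₁, a₂ algebraically independent over ℚ. -/
open MvPolynomial

/-- **Schanuel's Conjecture**: if `λ₁,…,λₙ ∈ ℂ` are `ℚ`-linearly independent,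
then the set `{λ₁,…,λₙ,e^{λ₁},…,e^{λₙ}}` contains `n` algebraically
independent elements (transcendence degree at least `n`). -/
def SchanuelConjecture : Prop :=
  ∀ (n : ℕ) (l : Fin n → ℂ), LinearIndependent ℚ l →
    ∃ f : Fin n → ℂ,
      (∀ i, f i ∈ Set.range l ∪ Set.range (fun i => Complex.exp (l i))) ∧
      AlgebraicIndependent ℚ f

/-- If a finite algebraically independent family is algebraic over the algebra generated by `s`,
then `s` contains an algebraically independent family of the same size. -/
theorem exists_algebraicIndependent_of_isAlgebraic_adjoin {K L : Type*} [Field K] [Field L]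
    [Algebra K L] {k : ℕ} {s : Set L} {f : Fin k → L} (hf : AlgebraicIndependent K f)
    (hs : ∀ i, IsAlgebraic (Algebra.adjoin K s) (f i)) :
    ∃ g : Fin k → L, (∀ i, g i ∈ s) ∧ AlgebraicIndependent K g := by
  have hle : (AlgebraicIndependent.matroid K L).eRk (Set.range f) ≤
      (AlgebraicIndependent.matroid K L).eRk s := by
    rw [← Matroid.eRk_closure_eq _ s]
    refine Matroid.eRk_mono _ ?_
    rw [AlgebraicIndependent.matroid_closure_eq]
    rintro _ ⟨i, rfl⟩
    exact hs i
  obtain ⟨B, hB⟩ := (AlgebraicIndependent.matroid K L).exists_isBasis s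
  rw [Matroid.Indep.eRk_eq_encard
    (AlgebraicIndependent.matroid_indep_iff.2 hf.to_subtype_range), ← hB.encard_eq_eRk,
    ← Set.image_univ, hf.injective.encard_image, Set.encard_univ, ENat.card_eq_coe_fintype_card,
    Fintype.card_fin] at hle
  obtain ⟨t, htB, ht⟩ := Set.exists_subset_encard_eq hle
  have htfin : t.Finite := Set.finite_of_encard_eq_coe ht
  have hcard : Nat.card t = k := by
    rw [Nat.card_coe_set_eq, Set.ncard_def, ht, ENat.toNat_natCast]
  have := htfin.to_subtype
  let e : Fin k ≃ t := (Finite.equivFinOfCardEq hcard).symm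
  refine ⟨fun i => e i, fun i => hB.subset (htB (e i).2), ?_⟩
  have hBi : AlgebraicIndepOn K id B := AlgebraicIndependent.matroid_indep_iff.1 hB.indep
  exact (hBi.mono htB).comp e e.injective

/-- The value at `a` of a polynomial with coefficients algebraic over `K` is algebraic over the
algebra generated by the coordinates of `a`. -/
theorem MvPolynomial.isAlgebraic_adjoin_range_eval {σ K L : Type*} [Fintype σ] [Field K] [Field L]
    [Algebra K L] (p : MvPolynomial σ L) (hp : ∀ m, IsAlgebraic K (coeff m p)) (a : σ → L) :
    IsAlgebraic (Algebra.adjoin K (Set.range a)) (eval a p) := by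
  rw [← Subalgebra.mem_algebraicClosure, eval_eq']
  refine sum_mem fun m _ => mul_mem ?_ (prod_mem fun i _ => pow_mem ?_ _)
  · rw [Subalgebra.mem_algebraicClosure]
    exact (hp m).extendScalars (algebraMap K (Algebra.adjoin K (Set.range a))).injective
  · exact isAlgebraic_algebraMap (⟨a i, Algebra.subset_adjoin (Set.mem_range_self i)⟩ :
      Algebra.adjoin K (Set.range a))

/-- A nonzero polynomial does not vanish identically on the multiples by `c ≠ 0` of the integer
points of a product of infinite sets. -/
theorem MvPolynomial.exists_int_eval_ne_zero {σ : Type*} {q : MvPolynomial σ ℂ} (hq : q ≠ 0)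
    {c : ℂ} (hc : c ≠ 0) (S : σ → Set ℤ) (hS : ∀ i, (S i).Infinite) :
    ∃ z : σ → ℤ, (∀ i, z i ∈ S i) ∧ eval (fun i => c * z i) q ≠ 0 := by
  by_contra! h
  refine hq (funext_set (fun i => (fun z : ℤ => c * z) '' S i) (fun i => ?_) fun x hx => ?_)
  · exact (hS i).image fun x _ y _ hxy => by simpa [hc] using hxy
  · choose z hz hzx using fun i => hx i (Set.mem_univ i)
    obtain rfl : (fun i => c * (z i : ℂ)) = x := _root_.funext hzx
    simpa using h z hz

theorem MvPolynomial.IsHomogeneous.eval_smul {σ R : Type*} [Fintype σ] [CommSemiring R]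
    {φ : MvPolynomial σ R} {k : ℕ} (hφ : φ.IsHomogeneous k) (t : R) (y : σ → R) :
    eval (t • y) φ = t ^ k * eval y φ := by
  rw [eval_eq', eval_eq', Finset.mul_sum]
  refine Finset.sum_congr rfl fun m hm => ?_
  have hk : ∑ i, m i = k := by
    rw [← Finsupp.degree_eq_sum, Finsupp.degree_eq_weight_one]
    exact hφ (mem_support_iff.1 hm)
  simp only [Pi.smul_apply, smul_eq_mul, mul_pow, Finset.prod_mul_distrib,
    Finset.prod_pow_eq_pow_sum, hk]
  ring

theorem MvPolynomial.homogeneousComponent_totalDegree_ne_zero {σ R : Type*} [CommSemiring R]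
    {p : MvPolynomial σ R} (hp : p ≠ 0) : homogeneousComponent p.totalDegree p ≠ 0 := by
  obtain ⟨m, hm, hmd⟩ := Finset.exists_mem_eq_sup p.support (support_nonempty.2 hp)
    fun s => s.sum fun _ e => e
  intro h
  have := congrArg (coeff m) h
  rw [coeff_homogeneousComponent, if_pos, coeff_zero] at this
  · exact mem_support_iff.1 hm this
  · exact hmd.symm

/-- The value at `(ε, y)` of the homogenization of `p`, where `ε` is the additional variable. -/
noncomputable def MvPolynomial.homogenizedEval {σ R : Type*} [CommSemiring R]
    (p : MvPolynomial σ R) (ε : R) (y : σ → R) : R :=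
  ∑ k ∈ Finset.range (p.totalDegree + 1),
    ε ^ (p.totalDegree - k) * eval y (homogeneousComponent k p)

theorem MvPolynomial.homogenizedEval_zero {σ R : Type*} [CommSemiring R] (p : MvPolynomial σ R)
    (y : σ → R) :
    p.homogenizedEval 0 y = eval y (homogeneousComponent p.totalDegree p) := by
  rw [homogenizedEval, Finset.sum_range_succ, Finset.sum_eq_zero]
  · simp
  · intro k hk
    rw [zero_pow (by have := Finset.mem_range.1 hk; omega), zero_mul]

theorem MvPolynomial.eval_smul_eq_homogenizedEval {σ K : Type*} [Fintype σ] [Field K]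
    (p : MvPolynomial σ K) {t : K} (ht : t ≠ 0) (y : σ → K) :
    eval (t • y) p = t ^ p.totalDegree * p.homogenizedEval t⁻¹ y := by
  conv_lhs => rw [← sum_homogeneousComponent p]
  rw [map_sum, homogenizedEval, Finset.mul_sum]
  refine Finset.sum_congr rfl fun k hk => ?_
  rw [(homogeneousComponent_isHomogeneous k p).eval_smul, ← mul_assoc]
  congr 1
  have hk' : k ≤ p.totalDegree := Nat.lt_succ_iff.1 (Finset.mem_range.1 hk)
  rw [inv_pow, ← div_eq_mul_inv, eq_div_iff (pow_ne_zero _ ht), ← pow_add,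
    Nat.add_sub_cancel' hk']

theorem MvPolynomial.contDiff_eval {σ : Type*} [Fintype σ] (p : MvPolynomial σ ℂ) {n : WithTop ℕ∞} :
    ContDiff ℂ n fun y : σ → ℂ => eval y p := by
  simp only [eval_eq']
  fun_prop

theorem MvPolynomial.contDiff_homogenizedEval {σ : Type*} [Fintype σ] (p : MvPolynomial σ ℂ)
    {n : WithTop ℕ∞} : ContDiff ℂ n fun x : ℂ × (σ → ℂ) => p.homogenizedEval x.1 x.2 := by
  unfold homogenizedEval
  refine ContDiff.sum fun k _ => ContDiff.mul (by fun_prop) ?_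
  exact (contDiff_eval _).comp contDiff_snd

open Filter Topology in
/-- The fixed point equation `t • v = log t • d + F (1 / t, v)` has arbitrarily small solutions `v`
for all large `t`, if `F` is continuously differentiable at the origin. -/
theorem eventually_exists_smul_eq_log_smul_add {E : Type*} [NormedAddCommGroup E]
    [NormedSpace ℂ E] [CompleteSpace E] {F : ℂ × E → E} (hF : ContDiffAt ℂ 1 F 0) (d : E)
    {N : Set (ℂ × E)} (hN : N ∈ 𝓝 0) :
    ∀ᶠ t : ℕ in atTop, ∃ v : E, ((t : ℂ)⁻¹, v) ∈ N ∧
      (t : ℂ) • v = (Real.log t : ℂ) • d + F ((t : ℂ)⁻¹, v) := by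
  let G : ℂ × ℂ × E → E := fun x => x.2.2 - x.2.1 • d - x.1 • F (x.1, x.2.2)
  let Φ : ℂ × ℂ × E → ℂ × ℂ × E := fun x => (x.1, x.2.1, G x)
  obtain ⟨F', hF'⟩ : ∃ F', HasStrictFDerivAt F F' 0 := ⟨_, hF.hasStrictFDerivAt one_ne_zero⟩
  have hFc : HasStrictFDerivAt (fun x : ℂ × ℂ × E => F (x.1, x.2.2))
      (F'.comp ((ContinuousLinearMap.fst ℂ ℂ (ℂ × E)).prod
        ((ContinuousLinearMap.snd ℂ ℂ E).comp (ContinuousLinearMap.snd ℂ ℂ (ℂ × E))))) 0 :=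
    HasStrictFDerivAt.comp (g := F) (0 : ℂ × ℂ × E) hF'
      (hasStrictFDerivAt_fst.prodMk (hasStrictFDerivAt_snd.comp 0 hasStrictFDerivAt_snd))
  have hΦ := (hasStrictFDerivAt_fst (𝕜 := ℂ) (p := (0 : ℂ × ℂ × E))).prodMk
    ((hasStrictFDerivAt_fst.comp (0 : ℂ × ℂ × E) (hasStrictFDerivAt_snd (𝕜 := ℂ))).prodMk
      (((hasStrictFDerivAt_snd.comp (0 : ℂ × ℂ × E) (hasStrictFDerivAt_snd (𝕜 := ℂ))).sub
        ((hasStrictFDerivAt_fst.comp (0 : ℂ × ℂ × E)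
          (hasStrictFDerivAt_snd (𝕜 := ℂ))).smul_const d)).sub
        (hasStrictFDerivAt_fst.smul hFc)))
  have hmap := hΦ.map_nhds_eq_of_surj (by
    refine LinearMap.range_eq_top.2 fun y => ⟨(y.1, y.2.1, y.2.2 + y.2.1 • d + y.1 • F 0), ?_⟩
    ext <;> simp [Prod.zero_eq_mk]
    abel)
  change map Φ (𝓝 0) = 𝓝 (Φ 0) at hmap
  have hΦ0 : Φ 0 = 0 := by simp [Φ, G]
  have hN' : {x : ℂ × ℂ × E | (x.1, x.2.2) ∈ N} ∈ 𝓝 (0 : ℂ × ℂ × E) :=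
    (by fun_prop : Continuous fun x : ℂ × ℂ × E => (x.1, x.2.2)).continuousAt.preimage_mem_nhds
      (by simpa [Prod.zero_eq_mk] using hN)
  have himage := image_mem_map (m := Φ) hN'
  rw [hmap, hΦ0] at himage
  have hinv : Tendsto (fun t : ℕ => (t : ℂ)⁻¹) atTop (𝓝 0) :=
    tendsto_inv_atTop_nhds_zero_nat (𝕜 := ℂ)
  have hlog : Tendsto (fun t : ℕ => ((Real.log t / t : ℝ) : ℂ)) atTop (𝓝 0) := by
    rw [← Complex.ofReal_zero]
    refine (Complex.continuous_ofReal.tendsto 0).comp ?_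
    exact Real.isLittleO_log_id_atTop.tendsto_div_nhds_zero.comp tendsto_natCast_atTop_atTop
  have htend : Tendsto (fun t : ℕ => ((t : ℂ)⁻¹, ((Real.log t / t : ℝ) : ℂ), (0 : E))) atTop
      (𝓝 0) := hinv.prodMk_nhds (hlog.prodMk_nhds tendsto_const_nhds)
  filter_upwards [htend himage, eventually_ne_atTop 0] with t ht ht0
  obtain ⟨⟨x, y, v⟩, hmem, hx⟩ := ht
  simp only [Φ, G, Prod.mk.injEq] at hx
  obtain ⟨rfl, rfl, hv⟩ := hx
  have ht0 : (t : ℂ) ≠ 0 := by exact_mod_cast ht0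
  refine ⟨v, hmem, ?_⟩
  have := congrArg ((t : ℂ) • ·) (sub_eq_zero.1 (sub_sub v _ _ ▸ hv))
  simp only [smul_add, smul_smul] at this
  rw [this, mul_inv_cancel₀ ht0, one_smul]
  congr 2
  push_cast
  field_simp

open Filter Topology in
/-- **Masser's theorem**, with asymptotics: if the leading forms of the `pᵢ` do not vanish at
`2πi z`, with `z` an integer vector, then for all large `t` the system `e^{xᵢ} = pᵢ(x)` has a
solution `x = t (2πi z + v)` with `v` small and `t vᵢ = deg pᵢ * log t + O(1)`. -/
theorem eventually_exists_exp_eq_eval {ι : Type*} [Fintype ι] (p : ι → MvPolynomial ι ℂ)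
    (z : ι → ℤ) (hz : ∀ i, eval (fun j => 2 * Real.pi * Complex.I * z j)
      (homogeneousComponent (p i).totalDegree (p i)) ≠ 0) :
    ∃ C : ℝ, ∀ᶠ t : ℕ in atTop, ∃ a v : ι → ℂ,
      (∀ i, a i = t * (2 * Real.pi * Complex.I * z i + v i)) ∧
      (∀ i, ‖v i‖ < 1) ∧ (∀ i, ‖t * v i - (p i).totalDegree * Real.log t‖ < C) ∧
      ∀ i, Complex.exp (a i) = eval a (p i) := by
  set w : ι → ℂ := fun j => 2 * Real.pi * Complex.I * z j
  let Q : ι → ℂ × (ι → ℂ) → ℂ := fun i x => (p i).homogenizedEval x.1 (w + x.2)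
  have hQ0 : ∀ i, Q i 0 ≠ 0 := fun i => by simpa [Q, homogenizedEval_zero] using hz i
  have hQ : ∀ i, ContDiff ℂ 1 (Q i) := fun i =>
    (contDiff_homogenizedEval (p i)).comp (f := fun x : ℂ × (ι → ℂ) => (x.1, w + x.2))
      (by fun_prop)
  let F : ℂ × (ι → ℂ) → ι → ℂ := fun x i => Complex.log (Q i x / Q i 0) + Complex.log (Q i 0)
  have hF : ContDiffAt ℂ 1 F 0 := by
    refine contDiffAt_pi.2 fun i => ContDiffAt.add
      (ContDiffAt.comp _ (Complex.contDiffAt_log ?_) ?_) contDiffAt_const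
    · simp [div_self (hQ0 i)]
    · exact (hQ i).contDiffAt.div_const _
  have hFbdd : ∀ᶠ x in 𝓝 (0 : ℂ × (ι → ℂ)), ‖F x‖ < ‖F 0‖ + 1 :=
    hF.continuousAt.norm.eventually_lt continuousAt_const (lt_add_one _)
  have hQne : ∀ᶠ x in 𝓝 (0 : ℂ × (ι → ℂ)), ∀ i, Q i x ≠ 0 :=
    eventually_all.2 fun i => (hQ i).continuous.continuousAt.eventually_ne (hQ0 i)
  have hsmall : ∀ᶠ x in 𝓝 (0 : ℂ × (ι → ℂ)), ‖x.2‖ < 1 :=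
    (by fun_prop : Continuous fun x : ℂ × (ι → ℂ) => ‖x.2‖).continuousAt.eventually_lt
      continuousAt_const (by simp)
  refine ⟨‖F 0‖ + 1, ?_⟩
  filter_upwards [eventually_exists_smul_eq_log_smul_add hF (fun i => ((p i).totalDegree : ℂ))
    (hFbdd.and (hQne.and hsmall)), eventually_ne_atTop 0] with t ⟨v, ⟨hv₁, hv₂, hv₃⟩, hv⟩ ht
  have htC : (t : ℂ) ≠ 0 := by exact_mod_cast ht
  have hvi : ∀ i, t * v i = Real.log t * (p i).totalDegree + F ((t : ℂ)⁻¹, v) i := fun i =>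
    congrFun hv i
  refine ⟨(t : ℂ) • (w + v), v, fun i => rfl, fun i => (norm_le_pi_norm v i).trans_lt hv₃,
    fun i => ?_, fun i => ?_⟩
  · rw [hvi, mul_comm, add_sub_cancel_left]
    exact (norm_le_pi_norm _ i).trans_lt hv₁
  · have ha : ((t : ℂ) • (w + v)) i = ((t * z i : ℤ) : ℂ) * (2 * Real.pi * Complex.I) +
        (((p i).totalDegree * Complex.log t) + F ((t : ℂ)⁻¹, v) i) := by
      simp only [Pi.smul_apply, Pi.add_apply, smul_eq_mul, mul_add, hvi, w]
      rw [← Complex.natCast_log]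
      push_cast
      ring
    rw [ha, Complex.exp_add, Complex.exp_int_mul_two_pi_mul_I, one_mul, Complex.exp_add,
      Complex.exp_nat_mul, Complex.exp_log htC, Complex.exp_add,
      Complex.exp_log (div_ne_zero (hv₂ i) (hQ0 i)), Complex.exp_log (hQ0 i),
      div_mul_cancel₀ _ (hQ0 i), eval_smul_eq_homogenizedEval _ htC]

/-- Two complex numbers in the open first and fourth quadrants are `ℚ`-linearly independent. -/
theorem Complex.linearIndependent_rat_of_re_pos_of_im {x y : ℂ} (hx : 0 < x.re) (hx' : 0 < x.im)
    (hy : 0 < y.re) (hy' : y.im < 0) : LinearIndependent ℚ ![x, y] := by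
  rw [LinearIndependent.pair_iff]
  intro r s h
  have hre := congrArg Complex.re h
  have him := congrArg Complex.im h
  simp only [Complex.add_re, Complex.add_im, Rat.smul_def, ← Complex.ofReal_ratCast,
    Complex.re_ofReal_mul, Complex.im_ofReal_mul, Complex.zero_re, Complex.zero_im] at hre him
  have hdet : 0 < x.im * y.re - x.re * y.im := by
    nlinarith [mul_pos hx' hy, mul_neg_of_pos_of_neg hx hy']
  have hr : (r : ℝ) * (x.im * y.re - x.re * y.im) = 0 := by
    linear_combination y.re * him - y.im * hre
  have hs : (s : ℝ) * (x.im * y.re - x.re * y.im) = 0 := by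
    linear_combination x.im * hre - x.re * him
  exact ⟨by exact_mod_cast (mul_eq_zero.1 hr).resolve_right hdet.ne',
    by exact_mod_cast (mul_eq_zero.1 hs).resolve_right hdet.ne'⟩

/-- (SC) For `n ≥ 2` and nonconstant polynomials `p₁,…,pₙ` with algebraic
coefficients, the system `e^{xᵢ} = pᵢ(x)` has a solution `a ∈ ℂⁿ` with
`td_ℚ(a₁,…,aₙ) ≥ 2`, i.e. two of the coordinates of `a` are algebraically
independent over `ℚ`. In particular for `n = 2` the solution is generic. -/
theorem system_has_solution_trdeg_ge_two
    (hSC : SchanuelConjecture) {n : ℕ} (hn : 2 ≤ n)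
    (p : Fin n → MvPolynomial (Fin n) ℂ)
    (hcoeff : ∀ i (mo : Fin n →₀ ℕ), IsAlgebraic ℚ (MvPolynomial.coeff mo (p i)))
    (hnc : ∀ i, (p i).totalDegree ≠ 0) :
    ∃ a : Fin n → ℂ,
      (∀ i, Complex.exp (a i) = MvPolynomial.eval a (p i)) ∧
      ∃ f : Fin 2 → ℂ, (∀ t, f t ∈ Set.range a) ∧ AlgebraicIndependent ℚ f := by
  classical
  have hp0 : ∀ i, p i ≠ 0 := fun i h => hnc i (by rw [h, totalDegree_zero])
  let i₀ : Fin n := ⟨0, by omega⟩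
  let i₁ : Fin n := ⟨1, by omega⟩
  have hne : i₀ ≠ i₁ := by simp [i₀, i₁]
  obtain ⟨z, hzS, hz⟩ := exists_int_eval_ne_zero
    (q := ∏ i, homogeneousComponent (p i).totalDegree (p i))
    (Finset.prod_ne_zero_iff.2 fun i _ => homogeneousComponent_totalDegree_ne_zero (hp0 i))
    Complex.two_pi_I_ne_zero (fun i => if i = i₁ then Set.Iio 0 else Set.Ioi 0)
    (fun i => by split_ifs; exacts [Set.Iio_infinite 0, Set.Ioi_infinite 0])
  rw [map_prod, Finset.prod_ne_zero_iff] at hz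
  have hz₀ : (1 : ℝ) ≤ z i₀ := by
    have := hzS i₀
    rw [if_neg hne] at this
    exact_mod_cast Int.add_one_le_of_lt (Set.mem_Ioi.1 this)
  have hz₁ : (z i₁ : ℝ) ≤ -1 := by
    have := hzS i₁
    rw [if_pos rfl] at this
    exact_mod_cast Int.le_sub_one_of_lt (Set.mem_Iio.1 this)
  obtain ⟨C, hC⟩ := eventually_exists_exp_eq_eval p z fun i => hz i (Finset.mem_univ i)
  obtain ⟨t, ⟨a, v, ha, hv, hvC, hsol⟩, hlog, ht⟩ := (hC.and
    (((Real.tendsto_log_atTop.comp tendsto_natCast_atTop_atTop).eventually_ge_atTop C).and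
      (Filter.eventually_gt_atTop 0))).exists
  have ht' : (0 : ℝ) < t := by exact_mod_cast ht
  have him : ∀ i, (a i).im = t * (2 * Real.pi * z i + (v i).im) := fun i => by
    rw [ha]; simp
  have hre : ∀ i, 0 < (a i).re := fun i => by
    have hrei : (a i).re = t * (v i).re := by rw [ha]; simp
    have h := ((Complex.abs_re_le_norm _).trans_lt (hvC i))
    have hd : (1 : ℝ) ≤ (p i).totalDegree := by
      exact_mod_cast Nat.one_le_iff_ne_zero.2 (hnc i)
    have hlog0 : 0 ≤ Real.log t := Real.log_natCast_nonneg t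
    have heq : ((t : ℂ) * v i - (p i).totalDegree * Real.log t).re =
        t * (v i).re - (p i).totalDegree * Real.log t := by simp [Complex.log_re]
    rw [heq] at h
    simp only [Function.comp_apply] at hlog
    rw [hrei]
    nlinarith [(abs_lt.1 h).1, mul_le_mul_of_nonneg_right hd hlog0]
  have hvim : ∀ i, |(v i).im| < 1 := fun i => (Complex.abs_im_le_norm _).trans_lt (hv i)
  have hlin : LinearIndependent ℚ ![a i₀, a i₁] := by
    refine Complex.linearIndependent_rat_of_re_pos_of_im (hre i₀) ?_ (hre i₁) ?_
    · rw [him]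
      refine mul_pos ht' ?_
      nlinarith [Real.pi_gt_three, (abs_lt.1 (hvim i₀)).1]
    · rw [him]
      refine mul_neg_of_pos_of_neg ht' ?_
      nlinarith [Real.pi_gt_three, (abs_lt.1 (hvim i₁)).2]
  obtain ⟨f, hf, hfind⟩ := hSC 2 _ hlin
  refine ⟨a, hsol, exists_algebraicIndependent_of_isAlgebraic_adjoin hfind fun i => ?_⟩
  have hmem : ∀ j, ∃ k, ![a i₀, a i₁] j = a k := fun j => by
    fin_cases j
    exacts [⟨i₀, rfl⟩, ⟨i₁, rfl⟩]
  rcases hf i with ⟨j, hj⟩ | ⟨j, hj⟩ <;> obtain ⟨k, hk⟩ := hmem j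
  · rw [← hj, hk]
    exact isAlgebraic_algebraMap (⟨a k, Algebra.subset_adjoin (Set.mem_range_self k)⟩ :
      Algebra.adjoin ℚ (Set.range a))
  · rw [← hj]
    simp only [hk, hsol]
    exact isAlgebraic_adjoin_range_eval (p k) (hcoeff k) a
end

section
/- Assume Schanuel's Conjecture. Let p₁,…,pₙ ∈ ℚ^alg[x₁,…,xₙ] with constant terms cᵢ = pᵢ(0) all nonzero and multiplicatively independent (for every nonzero m ∈ ℤⁿ, c₁^{m₁}⋯cₙ^{mₙ} ≠ 1). Then every solution a ∈ ℂⁿ of the system e^{x₁} = p₁(x), …, e^{xₙ} = pₙ(x) satisfies td_ℚ(a₁,…,aₙ) = n. -/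
open MvPolynomial

/-- If an algebraically independent family is algebraic over the subalgebra generated by a family
with the same finite index type, then the latter family is algebraically independent too. -/
theorem AlgebraicIndependent.of_isAlgebraic_adjoin_range {R A ι : Type*} [CommRing R] [CommRing A]
    [IsDomain A] [Algebra R A] [Finite ι] {f b : ι → A} (hf : AlgebraicIndependent R f)
    (h : ∀ i, IsAlgebraic (Algebra.adjoin R (Set.range b)) (f i)) :
    AlgebraicIndependent R b := by
  have := (faithfulSMul_iff_algebraMap_injective R A).mpr hf.algebraMap_injective
  have := (algebraMap R A).domain_nontrivial
  let M := AlgebraicIndependent.matroid R A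
  have hfM : M.Indep (Set.range f) :=
    AlgebraicIndependent.matroid_indep_iff.mpr hf.to_subtype_range
  have hsub : Set.range f ⊆ M.closure (Set.range b) := by
    rintro _ ⟨i, rfl⟩
    rw [AlgebraicIndependent.matroid_closure_eq]
    exact h i
  have hle : ENat.card ι ≤ M.eRk (Set.range b) := by
    refine hf.injective.encard_range.trans ?_
    rw [← hfM.eRk_eq_encard, ← M.eRk_closure_eq (Set.range b)]
    exact M.eRk_mono hsub
  have hb : (Set.range b).encard ≤ ENat.card ι := by
    rw [← Set.image_univ, ← Set.encard_univ]
    exact Set.encard_image_le b Set.univ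
  have hinj : Function.Injective b := by
    rw [← Set.injOn_univ]
    refine Set.finite_univ.injOn_of_encard_image_eq ?_
    rw [Set.image_univ, Set.encard_univ]
    exact hb.antisymm (hle.trans (M.eRk_le_encard _))
  have hbM : M.Indep (Set.range b) := by
    rw [M.indep_iff_eRk_eq_encard_of_finite (Set.finite_range b)]
    exact (M.eRk_le_encard _).antisymm (hb.trans hle)
  exact (algebraicIndependent_subtype_range hinj).mp
    (AlgebraicIndependent.matroid_indep_iff.mp hbM)

/-- Schanuel's conjecture implies that a finite `ℚ`-linearly independent family of complex numbers
whose exponentials are algebraic over it is algebraically independent. -/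
theorem SchanuelConjecture.algebraicIndependent (hSC : SchanuelConjecture) {ι : Type*} [Finite ι]
    {b : ι → ℂ} (hb : LinearIndependent ℚ b)
    (hexp : ∀ i, IsAlgebraic (Algebra.adjoin ℚ (Set.range b)) (Complex.exp (b i))) :
    AlgebraicIndependent ℚ b := by
  let e := (Finite.equivFin ι).symm
  obtain ⟨f, hf, hfi⟩ := hSC _ (b ∘ e) (hb.comp e e.injective)
  refine (algebraicIndependent_equiv e).mp (hfi.of_isAlgebraic_adjoin_range fun i => ?_)
  rw [e.surjective.range_comp]
  rcases hf i with ⟨j, hj⟩ | ⟨j, hj⟩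
  · rw [← hj]
    exact isAlgebraic_algebraMap
      (⟨b (e j), Algebra.subset_adjoin ⟨e j, rfl⟩⟩ : Algebra.adjoin ℚ (Set.range b))
  · rw [← hj]
    exact hexp (e j)

theorem MvPolynomial.isAlgebraic_eval {R A σ : Type*} [CommRing R] [CommRing A] [IsDomain R]
    [Algebra R A] {q : MvPolynomial σ A} {x : σ → A}
    (hq : ∀ mo, IsAlgebraic R (q.coeff mo)) (hx : ∀ i, IsAlgebraic R (x i)) :
    IsAlgebraic R (eval x q) := by
  rw [eval_eq]
  exact sum_mem (S := Subalgebra.algebraicClosure R A) fun mo _ =>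
    mul_mem (hq mo) (prod_mem fun i _ => pow_mem (hx i) _)

theorem Finset.prod_zpow_eq_one_iff {K ι : Type*} [Field K] (s : Finset ι) {z : ι → K}
    (hz : ∀ i, z i ≠ 0) (m : ι → ℤ) :
    ∏ i ∈ s, z i ^ m i = 1 ↔ ∏ i ∈ s, z i ^ (m i).toNat = ∏ i ∈ s, z i ^ (-m i).toNat := by
  have h : ∀ i ∈ s, z i ^ m i = z i ^ (m i).toNat / z i ^ (-m i).toNat := fun i _ => by
    rw [← zpow_natCast, ← zpow_natCast, ← zpow_sub₀ (hz i), Int.toNat_sub_toNat_neg]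
  rw [Finset.prod_congr rfl h, Finset.prod_div_distrib, div_eq_one_iff_eq]
  exact Finset.prod_ne_zero_iff.mpr fun i _ => pow_ne_zero _ (hz i)

/-- A multiplicative relation between polynomials with algebraic coefficients that holds at a
generic point of a rational linear subspace also holds at the origin. -/
theorem prod_constantCoeff_zpow_eq_one {ι κ : Type*} [Fintype ι] {p : ι → MvPolynomial ι ℂ}
    (hcoeff : ∀ i mo, IsAlgebraic ℚ (coeff mo (p i)))
    (hc0 : ∀ i, constantCoeff (p i) ≠ 0) {a : ι → ℂ} {b : κ → ℂ}
    (hb : AlgebraicIndependent ℚ b) (hab : ∀ i, a i ∈ Submodule.span ℚ (Set.range b))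
    (hne : ∀ i, eval a (p i) ≠ 0) (m : ι → ℤ) (hm : ∏ i, eval a (p i) ^ m i = 1) :
    ∏ i, constantCoeff (p i) ^ m i = 1 := by
  let K := Subalgebra.algebraicClosure ℚ ℂ
  have hbK : AlgebraicIndependent K b := hb.subalgebraAlgebraicClosure
  have hlift : ∀ i, ∃ P : MvPolynomial ι K, map (algebraMap K ℂ) P = p i := fun i =>
    mem_range_map_iff_coeffs_subset.mpr fun c hc => by
      obtain ⟨mo, -, rfl⟩ := mem_coeffs_iff.mp hc
      exact ⟨⟨_, hcoeff i mo⟩, rfl⟩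
  choose P hP using hlift
  have hlin : ∀ x ∈ Submodule.span ℚ (Set.range b),
      ∃ l : MvPolynomial κ K, aeval b l = x ∧ aeval (0 : κ → ℂ) l = 0 := fun x hx => by
    induction hx using Submodule.span_induction with
    | mem x hx =>
      obtain ⟨j, rfl⟩ := hx
      exact ⟨X j, by simp, by simp⟩
    | zero => exact ⟨0, by simp, by simp⟩
    | add x y _ _ hx hy =>
      obtain ⟨l, hl, hl0⟩ := hx
      obtain ⟨k, hk, hk0⟩ := hy
      exact ⟨l + k, by rw [map_add, hl, hk], by rw [map_add, hl0, hk0, add_zero]⟩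
    | smul r x _ hx =>
      obtain ⟨l, hl, hl0⟩ := hx
      exact ⟨r • l, by rw [map_rat_smul, hl], by rw [map_rat_smul, hl0, smul_zero]⟩
  choose l hl hl0 using fun i => hlin (a i) (hab i)
  have heval : ∀ (y : κ → ℂ) (i : ι),
      aeval y (bind₁ l (P i)) = eval (fun k => aeval y (l k)) (p i) := fun y i => by
    rw [aeval_bind₁, ← hP i, eval_map, aeval_def]
  have hevalb : ∀ i, aeval b (bind₁ l (P i)) = eval a (p i) := fun i => by
    rw [heval]
    simp only [hl]
  have heval0 : ∀ i, aeval (0 : κ → ℂ) (bind₁ l (P i)) = constantCoeff (p i) := fun i => by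
    rw [heval, ← eval_zero]
    simp only [hl0]
    rfl
  have hrel : ∏ i, bind₁ l (P i) ^ (m i).toNat = ∏ i, bind₁ l (P i) ^ (-m i).toNat := by
    apply hbK
    simpa [map_prod, hevalb] using (Finset.univ.prod_zpow_eq_one_iff hne m).mp hm
  refine (Finset.univ.prod_zpow_eq_one_iff hc0 m).mpr ?_
  simpa only [map_prod, map_pow, heval0] using congrArg (aeval (0 : κ → ℂ)) hrel

/-- (SC) If `p₁,…,pₙ` have algebraic coefficients and nonzero,
multiplicatively independent constant terms `cᵢ = pᵢ(0)`, then every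
solution `a ∈ ℂⁿ` of the system `e^{xᵢ} = pᵢ(x)` is generic:
`td_ℚ(a₁,…,aₙ) = n`, i.e. `a₁,…,aₙ` are algebraically independent. -/
theorem all_solutions_generic_of_multiplicatively_independent
    (hSC : SchanuelConjecture) {n : ℕ}
    (p : Fin n → MvPolynomial (Fin n) ℂ)
    (hcoeff : ∀ i (mo : Fin n →₀ ℕ), IsAlgebraic ℚ (MvPolynomial.coeff mo (p i)))
    (hc0 : ∀ i, MvPolynomial.constantCoeff (p i) ≠ 0)
    (hmult : ∀ m : Fin n → ℤ, m ≠ 0 →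
      ∏ i, (MvPolynomial.constantCoeff (p i)) ^ (m i) ≠ 1)
    (a : Fin n → ℂ)
    (hsol : ∀ i, Complex.exp (a i) = MvPolynomial.eval a (p i)) :
    AlgebraicIndependent ℚ a := by
  obtain ⟨κ, g, hg, hspan, hli⟩ := exists_linearIndependent' ℚ a
  have : Finite κ := Finite.of_injective g hg
  have halg : ∀ {ι : Type} [Finite ι] (b : ι → ℂ), LinearIndependent ℚ b →
      (∀ j, ∃ i, b j = a i) → (∀ i, a i ∈ Submodule.span ℚ (Set.range b)) →
      AlgebraicIndependent ℚ b := fun b hb hba hab =>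
    hSC.algebraicIndependent hb fun j => by
      obtain ⟨i, hi⟩ := hba j
      rw [hi, hsol i]
      refine isAlgebraic_eval (fun mo => (hcoeff i mo).extendScalars
        (FaithfulSMul.algebraMap_injective ℚ _)) fun k => ?_
      exact isAlgebraic_algebraMap
        (⟨a k, Algebra.span_le_adjoin ℚ _ (hab k)⟩ : Algebra.adjoin ℚ (Set.range b))
  by_cases hli_a : LinearIndependent ℚ a
  · exact halg a hli_a (fun j => ⟨j, rfl⟩) fun i => Submodule.subset_span ⟨i, rfl⟩
  have hab : ∀ i, a i ∈ Submodule.span ℚ (Set.range (a ∘ g)) := fun i =>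
    hspan ▸ Submodule.subset_span ⟨i, rfl⟩
  rw [← LinearIndependent.iff_fractionRing ℤ ℚ, Fintype.not_linearIndependent_iff] at hli_a
  obtain ⟨m, hm, i, hi⟩ := hli_a
  refine absurd ?_ (hmult m fun h => hi (congrFun h i))
  refine prod_constantCoeff_zpow_eq_one hcoeff hc0 (halg (a ∘ g) hli (fun j => ⟨g j, rfl⟩) hab) hab
    (fun i => hsol i ▸ Complex.exp_ne_zero _) m ?_
  simp only [← hsol, ← Complex.exp_int_mul, ← Complex.exp_sum]
  simp only [zsmul_eq_mul] at hm
  rw [hm, Complex.exp_zero]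
end

section
/- Assume Schanuel's Conjecture. Let p(x,y) ∈ ℚ^alg[x,y] be a nonzero irreducible polynomial depending on both x and y. Then there exists w ∈ ℂ such that p(w, e^{e^w}) = 0 and td_ℚ(w, e^w, e^{e^w}) = 2. -/
open MvPolynomial

/-- `HasTrdeg S d` says that the transcendence degree over `ℚ` of the field
generated by the set `S ⊆ ℂ` equals `d`: `S` contains `d` algebraically
independent elements, and no more. -/
def HasTrdeg (S : Set ℂ) (d : ℕ) : Prop :=
  (∃ f : Fin d → ℂ, (∀ i, f i ∈ S) ∧ AlgebraicIndependent ℚ f) ∧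
    ∀ (e : ℕ) (g : Fin e → ℂ), (∀ i, g i ∈ S) → AlgebraicIndependent ℚ g → e ≤ d

/-- A polynomial in several complex variables grows at most like a power of the variables. -/
lemma MvPolynomial.exists_norm_eval_le_pow {σ : Type*} (p : MvPolynomial σ ℂ) :
    ∃ M : ℕ, ∀ T : ℝ, 2 ≤ T → ∀ v : σ → ℂ, (∀ i, ‖v i‖ ≤ T) → ‖eval v p‖ ≤ T ^ M := by
  induction p using MvPolynomial.induction_on with
  | C a =>
    obtain ⟨M, hM⟩ := pow_unbounded_of_one_lt ‖a‖ (one_lt_two : (1 : ℝ) < 2)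
    refine ⟨M, fun T hT v _ => ?_⟩
    rw [eval_C]
    exact hM.le.trans (pow_le_pow_left₀ (by norm_num) hT M)
  | add p q hp hq =>
    obtain ⟨M, hM⟩ := hp
    obtain ⟨N, hN⟩ := hq
    refine ⟨max M N + 1, fun T hT v hv => ?_⟩
    have h1 : T ^ M ≤ T ^ max M N := pow_le_pow_right₀ (by linarith) (le_max_left _ _)
    have h2 : T ^ N ≤ T ^ max M N := pow_le_pow_right₀ (by linarith) (le_max_right _ _)
    have h3 : (0 : ℝ) ≤ T ^ max M N := by positivity
    rw [eval_add, pow_succ]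
    have := norm_add_le (eval v p) (eval v q)
    have := hM T hT v hv
    have := hN T hT v hv
    nlinarith
  | mul_X p i hp =>
    obtain ⟨M, hM⟩ := hp
    refine ⟨M + 1, fun T hT v hv => ?_⟩
    rw [eval_mul, eval_X, norm_mul, pow_succ]
    exact mul_le_mul (hM T hT v hv) (hv i) (norm_nonneg _) (by positivity)

/-- A polynomial in several complex variables is Lipschitz on polydiscs, with a constant growing
at most like a power of the radius. -/
lemma MvPolynomial.exists_norm_eval_sub_eval_le {σ : Type*} [Fintype σ] (p : MvPolynomial σ ℂ) :
    ∃ M : ℕ, ∀ T : ℝ, 2 ≤ T → ∀ v v' : σ → ℂ, (∀ i, ‖v i‖ ≤ T) → (∀ i, ‖v' i‖ ≤ T) →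
      ‖eval v p - eval v' p‖ ≤ T ^ M * ‖v - v'‖ := by
  induction p using MvPolynomial.induction_on with
  | C a => exact ⟨0, fun T hT v v' _ _ => by simp⟩
  | add p q hp hq =>
    obtain ⟨M, hM⟩ := hp
    obtain ⟨N, hN⟩ := hq
    refine ⟨max M N + 1, fun T hT v v' hv hv' => ?_⟩
    have h1 : T ^ M ≤ T ^ max M N := pow_le_pow_right₀ (by linarith) (le_max_left _ _)
    have h2 : T ^ N ≤ T ^ max M N := pow_le_pow_right₀ (by linarith) (le_max_right _ _)
    rw [eval_add, eval_add, add_sub_add_comm]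
    calc _ ≤ ‖eval v p - eval v' p‖ + ‖eval v q - eval v' q‖ := norm_add_le _ _
      _ ≤ T ^ M * ‖v - v'‖ + T ^ N * ‖v - v'‖ :=
          add_le_add (hM T hT v v' hv hv') (hN T hT v v' hv hv')
      _ ≤ T ^ max M N * ‖v - v'‖ + T ^ max M N * ‖v - v'‖ := by gcongr
      _ = (T ^ max M N * 2) * ‖v - v'‖ := by ring
      _ ≤ (T ^ max M N * T) * ‖v - v'‖ := by gcongr
      _ = _ := by rw [pow_succ]
  | mul_X p i hp =>
    obtain ⟨M, hM⟩ := hp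
    obtain ⟨N, hN⟩ := p.exists_norm_eval_le_pow
    refine ⟨max M N + 2, fun T hT v v' hv hv' => ?_⟩
    have h1 : T ^ M ≤ T ^ max M N := pow_le_pow_right₀ (by linarith) (le_max_left _ _)
    have h2 : T ^ N ≤ T ^ max M N := pow_le_pow_right₀ (by linarith) (le_max_right _ _)
    have hi : ‖v i - v' i‖ ≤ ‖v - v'‖ := norm_le_pi_norm (v - v') i
    rw [eval_mul, eval_mul, eval_X, eval_X]
    calc ‖eval v p * v i - eval v' p * v' i‖
        = ‖eval v p * (v i - v' i) + (eval v p - eval v' p) * v' i‖ := by ring_nf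
      _ ≤ ‖eval v p‖ * ‖v i - v' i‖ + ‖eval v p - eval v' p‖ * ‖v' i‖ := by
          rw [← norm_mul, ← norm_mul]; exact norm_add_le _ _
      _ ≤ T ^ max M N * ‖v - v'‖ + (T ^ max M N * ‖v - v'‖) * T := by
          gcongr
          · exact (hN T hT v hv).trans h2
          · exact (hM T hT v v' hv hv').trans (by gcongr)
          · exact hv' i
      _ = (T ^ max M N * (1 + T)) * ‖v - v'‖ := by ring
      _ ≤ (T ^ max M N * T ^ 2) * ‖v - v'‖ := by gcongr; nlinarith
      _ = _ := by rw [pow_add]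

/-- A nonzero complex polynomial is bounded away from zero near infinity. -/
lemma Polynomial.exists_le_norm_eval {a : Polynomial ℂ} (ha : a ≠ 0) :
    ∃ c > 0, ∃ R : ℝ, ∀ x : ℂ, R ≤ ‖x‖ → c ≤ ‖a.eval x‖ := by
  by_cases hd : 0 < a.degree
  · have h := a.tendsto_norm_atTop hd (tendsto_norm_cobounded_atTop (E := ℂ))
    have h1 := h.eventually_ge_atTop 1
    rw [← comap_norm_atTop, Filter.eventually_comap, Filter.eventually_atTop] at h1
    obtain ⟨R, hR⟩ := h1
    exact ⟨1, one_pos, R, fun x hx => hR _ hx x rfl⟩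
  · rw [Polynomial.eq_C_of_degree_le_zero (not_lt.mp hd)] at ha ⊢
    refine ⟨‖a.coeff 0‖, norm_pos_iff.mpr fun h => ha (by rw [h, Polynomial.C_0]), 0, fun x _ => ?_⟩
    rw [Polynomial.eval_C]

/-- Finitely many points leave a gap of definite size in any interval. -/
lemma exists_mem_Icc_forall_le_abs_sub (t : Multiset ℝ) (a b : ℝ) (hab : a < b) :
    ∃ ρ ∈ Set.Icc a b, ∀ x ∈ t, (b - a) / 6 ^ t.card ≤ |ρ - x| := by
  induction t using Multiset.induction_on generalizing a b with
  | empty => exact ⟨a, ⟨le_rfl, hab.le⟩, by simp⟩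
  | cons y t ih =>
    have key : ∀ a' b' : ℝ, a ≤ a' → b' ≤ b → b' - a' = (b - a) / 3 →
        (∀ ρ ∈ Set.Icc a' b', (b - a) / 6 ≤ |ρ - y|) →
        ∃ ρ ∈ Set.Icc a b, ∀ x ∈ y ::ₘ t, (b - a) / 6 ^ (y ::ₘ t).card ≤ |ρ - x| := by
      intro a' b' ha hb hlen hy
      obtain ⟨ρ, hρ, h⟩ := ih a' b' (by linarith)
      refine ⟨ρ, ⟨ha.trans hρ.1, hρ.2.trans hb⟩, fun x hx => ?_⟩
      rw [Multiset.card_cons, pow_succ', ← div_div]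
      rcases Multiset.mem_cons.mp hx with rfl | hx
      · exact (div_le_self (by linarith) (one_le_pow₀ (by norm_num))).trans (hy ρ hρ)
      · refine le_trans ?_ (h x hx)
        rw [hlen]
        gcongr; linarith
    rcases le_total y ((a + b) / 2) with hy | hy
    · refine key (b - (b - a) / 3) b (by linarith) le_rfl (by ring) fun ρ hρ => ?_
      exact le_trans (by linarith [hρ.1]) (le_abs_self _)
    · refine key a (a + (b - a) / 3) le_rfl (by linarith) (by ring) fun ρ hρ => ?_
      exact le_trans (by linarith [hρ.2]) (neg_le_abs _)

/-- A holomorphic function much smaller at the centre of a disc than on its boundary circle has a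
zero in the disc. -/
lemma exists_mem_closedBall_eq_zero {f : ℂ → ℂ} {z₀ : ℂ} {r R m : ℝ}
    (hf : DifferentiableOn ℂ f (Metric.ball z₀ R)) (hr : 0 < r) (hrR : r < R)
    (hm : ∀ z ∈ Metric.sphere z₀ r, m ≤ ‖f z‖) (h0 : 3 * ‖f z₀‖ < m) :
    ∃ z ∈ Metric.closedBall z₀ r, f z = 0 := by
  have hε : ∀ z ∈ Metric.sphere z₀ r, m - ‖f z₀‖ ≤ ‖f z - f z₀‖ := fun z hz => by
    linarith [hm z hz, norm_sub_norm_le (f z) (f z₀)]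
  have hball : Metric.closedBall z₀ r ⊆ Metric.ball z₀ R := Metric.closedBall_subset_ball hrR
  have hd : DiffContOnCl ℂ f (Metric.ball z₀ r) :=
    (hf.mono (closure_ball z₀ hr.ne' ▸ hball)).diffContOnCl
  have hfreq : ∃ᶠ z in nhds z₀, f z ≠ f z₀ := by
    intro hev
    have hcon : Set.EqOn f (fun _ => f z₀) (Metric.ball z₀ R) :=
      (hf.analyticOnNhd Metric.isOpen_ball).eqOn_of_preconnected_of_eventuallyEq
        analyticOnNhd_const (convex_ball z₀ R).isPreconnected
        (Metric.mem_ball_self (hr.trans hrR)) (by filter_upwards [hev] with z hz using not_not.mp hz)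
    have hz : z₀ + r ∈ Metric.sphere z₀ r := by simp [abs_of_pos hr]
    have h1 := hε _ hz
    rw [hcon (hball (Metric.sphere_subset_closedBall hz)), sub_self, norm_zero] at h1
    linarith [norm_nonneg (f z₀)]
  have hz : (0 : ℂ) ∈ Metric.ball (f z₀) ((m - ‖f z₀‖) / 2) := by
    rw [Metric.mem_ball, dist_zero_left]
    linarith
  exact (hd.ball_subset_image_closedBall hr hε hfreq) hz

/-- An irreducible polynomial depending on both `x` and `y`, viewed in `ℂ[x][y]`, has positive
degree and nonzero constant coefficient. -/
lemma exists_bivariate_form (p : MvPolynomial (Fin 2) ℂ) (hirr : Irreducible p)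
    (hx : degreeOf 0 p ≠ 0) (hy : degreeOf 1 p ≠ 0) :
    ∃ P : Polynomial (Polynomial ℂ), P.natDegree ≠ 0 ∧ P.coeff 0 ≠ 0 ∧
      ∀ x y, (P.map (Polynomial.evalRingHom x)).eval y = eval ![x, y] p := by
  let Φ : MvPolynomial (Fin 2) ℂ →ₐ[ℂ] Polynomial (Polynomial ℂ) :=
    aeval ![Polynomial.C Polynomial.X, Polynomial.X]
  let Ψ : Polynomial (Polynomial ℂ) →+* MvPolynomial (Fin 2) ℂ :=
    Polynomial.eval₂RingHom (Polynomial.aeval (X 0)).toRingHom (X 1)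
  have hΨΦ : Ψ (Φ p) = p := by
    have : Ψ.comp Φ.toRingHom = RingHom.id _ := by
      ext i
      · simp [Φ, Ψ]
      · fin_cases i <;> simp [Φ, Ψ]
    exact RingHom.congr_fun this p
  refine ⟨Φ p, fun h => hy ?_, fun h => hx ?_, fun x y => ?_⟩
  · rw [Polynomial.eq_C_of_natDegree_eq_zero h] at hΨΦ
    rw [← hΨΦ]
    generalize (Φ p).coeff 0 = a
    have : Ψ (Polynomial.C a) = rename (fun _ : Unit => (0 : Fin 2))
        (Polynomial.aeval (X () : MvPolynomial Unit ℂ) a) := by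
      rw [← Polynomial.aeval_algHom_apply]
      simp [Ψ]
    rw [this]
    by_contra hne
    simpa using vars_rename _ _ (mem_vars_iff_degreeOf_ne_zero.mpr hne)
  · obtain ⟨q, hq⟩ := Polynomial.X_dvd_iff.mpr h
    have hdvd : X 1 ∣ p := ⟨Ψ q, by rw [← hΨΦ, hq, map_mul]; simp [Ψ]⟩
    obtain ⟨u, hu⟩ := (X_prime (R := ℂ) (i := (1 : Fin 2))).irreducible.associated_of_dvd hirr hdvd
    obtain ⟨r, hr, hur⟩ := isUnit_iff_eq_C_of_isReduced.mp u.isUnit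
    rw [← hu, hur, mul_comm, degreeOf_C_mul _ _ (mem_nonZeroDivisors_of_ne_zero hr.ne_zero)]
    rw [degreeOf_X]
    simp
  · have : ((Polynomial.evalRingHom y).comp ((Polynomial.mapRingHom
        (Polynomial.evalRingHom x)).comp Φ.toRingHom)) = eval ![x, y] := by
      ext i
      · simp [Φ]
      · fin_cases i <;> simp [Φ]
    exact RingHom.congr_fun this p

/-- Far out, the polynomial `p(x, ·)` splits into a fixed number of linear factors, with leading
and constant coefficients bounded away from zero. -/
lemma exists_factorization (p : MvPolynomial (Fin 2) ℂ) (hirr : Irreducible p)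
    (hx : degreeOf 0 p ≠ 0) (hy : degreeOf 1 p ≠ 0) :
    ∃ d : ℕ, d ≠ 0 ∧ ∃ c > 0, ∃ R : ℝ, ∀ x : ℂ, R ≤ ‖x‖ →
      c ≤ ‖eval ![x, 0] p‖ ∧ ∃ (l : ℂ) (s : Multiset ℂ), c ≤ ‖l‖ ∧ s.card = d ∧
        ∀ y, eval ![x, y] p = l * (s.map fun r => y - r).prod := by
  obtain ⟨P, hd, h0, hP⟩ := exists_bivariate_form p hirr hx hy
  have hlead : P.leadingCoeff ≠ 0 := by
    rw [Ne, Polynomial.leadingCoeff_eq_zero]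
    rintro rfl
    simp at hd
  obtain ⟨c₁, hc₁, R₁, h₁⟩ := Polynomial.exists_le_norm_eval hlead
  obtain ⟨c₂, hc₂, R₂, h₂⟩ := Polynomial.exists_le_norm_eval h0
  refine ⟨P.natDegree, hd, min c₁ c₂, lt_min hc₁ hc₂, max R₁ R₂, fun x hx => ⟨?_, ?_⟩⟩
  · rw [← hP, ← Polynomial.coeff_zero_eq_eval_zero, Polynomial.coeff_map]
    exact (min_le_right _ _).trans (h₂ x ((le_max_right _ _).trans hx))
  · have hl := (min_le_left c₁ c₂).trans (h₁ x ((le_max_left _ _).trans hx))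
    have hne : Polynomial.evalRingHom x P.leadingCoeff ≠ 0 :=
      norm_pos_iff.mp ((lt_min hc₁ hc₂).trans_le hl)
    have hsp := IsAlgClosed.splits (P.map (Polynomial.evalRingHom x))
    refine ⟨P.leadingCoeff.eval x, (P.map (Polynomial.evalRingHom x)).roots, hl, ?_, fun y => ?_⟩
    · rw [← hsp.natDegree_eq_card_roots, Polynomial.natDegree_map_of_leadingCoeff_ne_zero _ hne]
    · rw [← hP]
      conv_lhs => rw [hsp.eq_prod_roots]
      rw [Polynomial.leadingCoeff_map_of_leadingCoeff_ne_zero _ hne, Polynomial.eval_mul,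
        Polynomial.eval_C, Polynomial.eval_multiset_prod, Multiset.map_map]
      simp

lemma Multiset.pow_card_le_norm_prod_sub {s : Multiset ℂ} {y : ℂ} {B : ℝ} (hB : 0 ≤ B)
    (h : ∀ r ∈ s, B ≤ ‖y - r‖) : B ^ s.card ≤ ‖(s.map fun r => y - r).prod‖ := by
  induction s using Multiset.induction_on with
  | empty => simp
  | cons r s ih =>
    rw [Multiset.card_cons, Multiset.map_cons, Multiset.prod_cons, norm_mul, pow_succ']
    exact mul_le_mul (h r (Multiset.mem_cons_self r s))
      (ih fun r' hr' => h r' (Multiset.mem_cons_of_mem hr')) (by positivity) (norm_nonneg _)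

lemma MvPolynomial.differentiableOn_eval {σ : Type*} (p : MvPolynomial σ ℂ) {g : ℂ → σ → ℂ}
    {U : Set ℂ} (hg : ∀ i, DifferentiableOn ℂ (fun y => g y i) U) :
    DifferentiableOn ℂ (fun y => eval (g y) p) U := by
  induction p using MvPolynomial.induction_on with
  | C a => simp
  | add p q hp hq =>
    simp only [eval_add]
    exact hp.add hq
  | mul_X p i hp =>
    simp only [eval_mul, eval_X]
    exact hp.mul (hg i)

/-- Starting from a root `y₀` of `p(x, ·)`, where `exp x` is a large multiple of `2πi`, perturb
`x` to obtain a zero of `p(w, exp (exp w))`. -/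
lemma exists_zero_of_approximate_zero (p : MvPolynomial (Fin 2) ℂ) {x y₀ : ℂ} {S m ρ : ℝ} {M : ℕ}
    (hL : ∀ v v' : Fin 2 → ℂ, (∀ i, ‖v i‖ ≤ S) → (∀ i, ‖v' i‖ ≤ S) →
      ‖eval v p - eval v' p‖ ≤ S ^ M * ‖v - v'‖)
    (hexp : Complex.exp (Complex.exp x) = 1) (hy₀ : y₀ ≠ 0) (hroot : eval ![x, y₀] p = 0)
    (hyS : 2 * ‖y₀‖ ≤ S) (hlogS : ‖Complex.log y₀‖ + 1 ≤ S) (hxS : ‖x‖ + 1 ≤ S)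
    (hρ : 0 < ρ) (hρ' : ρ < 1 / 2)
    (hm : ∀ y, ‖y - y₀‖ = ρ * ‖y₀‖ → m ≤ ‖eval ![x, y] p‖)
    (hS : S / ‖Complex.exp x‖ ≤ 1 / 4) (hsmall : 4 * (S ^ M * (2 * (S / ‖Complex.exp x‖))) < m) :
    ∃ w : ℂ, eval ![w, Complex.exp (Complex.exp w)] p = 0 ∧ ‖w - x‖ ≤ 1 ∧
      ‖Complex.exp w - Complex.exp x‖ ≤ ‖Complex.exp x‖ / 4 := by
  have hS0 : 0 ≤ S := le_trans (by positivity) hyS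
  have ha : Complex.exp x ≠ 0 := Complex.exp_ne_zero x
  have ha0 : 0 < ‖Complex.exp x‖ := norm_pos_iff.mpr ha
  have hy0 : 0 < ‖y₀‖ := norm_pos_iff.mpr hy₀
  set a := Complex.exp x with ha_def
  let s : ℂ → ℂ := fun y => Complex.log y₀ + Complex.log (1 + (y - y₀) / y₀)
  let z : ℂ → ℂ := fun y => x + Complex.log (1 + s y / a)
  have hq : ∀ y ∈ Metric.ball y₀ (‖y₀‖ / 2), ‖(y - y₀) / y₀‖ ≤ 1 / 2 := fun y hy => by
    rw [norm_div, div_le_iff₀ hy0]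
    linarith [mem_ball_iff_norm.mp hy]
  have hs : ∀ y ∈ Metric.ball y₀ (‖y₀‖ / 2), ‖s y‖ ≤ S := fun y hy => by
    have h1 := Complex.norm_log_one_add_half_le_self (hq y hy)
    have h2 := norm_add_le (Complex.log y₀) (Complex.log (1 + (y - y₀) / y₀))
    linarith [hq y hy]
  have hsa : ∀ y ∈ Metric.ball y₀ (‖y₀‖ / 2), ‖s y / a‖ ≤ S / ‖a‖ := fun y hy => by
    rw [norm_div]
    gcongr
    exact hs y hy
  have hz : ∀ y ∈ Metric.ball y₀ (‖y₀‖ / 2), ‖z y - x‖ ≤ 2 * (S / ‖a‖) := fun y hy => by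
    have h1 := hsa y hy
    have h2 := Complex.norm_log_one_add_half_le_self (z := s y / a) (by linarith)
    simp only [z, add_sub_cancel_left]
    linarith [norm_nonneg (s y / a)]
  have hslit : ∀ q : ℂ, ‖q‖ ≤ 1 / 2 → 1 + q ∈ Complex.slitPlane := fun q hq =>
    Complex.mem_slitPlane_of_norm_lt_one (by linarith)
  have hexps : ∀ y ∈ Metric.ball y₀ (‖y₀‖ / 2), Complex.exp (s y) = y := fun y hy => by
    rw [Complex.exp_add, Complex.exp_log hy₀,
      Complex.exp_log (Complex.slitPlane_ne_zero (hslit _ (hq y hy)))]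
    field_simp
    ring
  have hexpz : ∀ y ∈ Metric.ball y₀ (‖y₀‖ / 2), Complex.exp (z y) = a + s y := fun y hy => by
    rw [Complex.exp_add, Complex.exp_log (Complex.slitPlane_ne_zero
      (hslit _ ((hsa y hy).trans (by linarith))))]
    rw [← ha_def]
    field_simp
  have hclose : ∀ y ∈ Metric.ball y₀ (‖y₀‖ / 2),
      ‖eval ![z y, y] p - eval ![x, y] p‖ ≤ S ^ M * (2 * (S / ‖a‖)) := fun y hy => by
    have hyn : ‖y‖ ≤ S := by
      have := norm_add_le (y - y₀) y₀
      rw [sub_add_cancel] at this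
      linarith [mem_ball_iff_norm.mp hy]
    have hzn : ‖z y‖ ≤ S := by
      have := norm_add_le (z y - x) x
      rw [sub_add_cancel] at this
      linarith [hz y hy]
    refine (hL _ _ ?_ ?_).trans ?_
    · intro i; fin_cases i <;> simpa
    · intro i; fin_cases i
      · simp; linarith
      · simpa
    · gcongr
      refine (pi_norm_le_iff_of_nonneg (by positivity)).mpr fun i => ?_
      fin_cases i
      · simpa using hz y hy
      · simp; positivity
  have hdiff : DifferentiableOn ℂ (fun y => eval ![z y, y] p) (Metric.ball y₀ (‖y₀‖ / 2)) := by
    have hds : DifferentiableOn ℂ s (Metric.ball y₀ (‖y₀‖ / 2)) :=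
      (DifferentiableOn.clog (by fun_prop) fun y hy => hslit _ (hq y hy)).const_add _
    have hdz : DifferentiableOn ℂ z (Metric.ball y₀ (‖y₀‖ / 2)) :=
      (DifferentiableOn.clog (by fun_prop)
        fun y hy => hslit _ ((hsa y hy).trans (by linarith))).const_add _
    refine p.differentiableOn_eval fun i => ?_
    fin_cases i
    · exact hdz
    · exact differentiableOn_id
  have hrR : ρ * ‖y₀‖ < ‖y₀‖ / 2 := by nlinarith
  obtain ⟨y, hy, hy0⟩ := exists_mem_closedBall_eq_zero (m := m - S ^ M * (2 * (S / ‖a‖))) hdiff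
    (by positivity) hrR
    (fun y hy => by
      have h1 := hclose y (Metric.closedBall_subset_ball hrR (Metric.sphere_subset_closedBall hy))
      have h2 := hm y (mem_sphere_iff_norm.mp hy)
      have h3 := norm_sub_norm_le (eval ![x, y] p) (eval ![z y, y] p)
      rw [norm_sub_rev] at h3
      linarith)
    (by
      have h1 := hclose y₀ (Metric.mem_ball_self (by positivity))
      rw [hroot, sub_zero] at h1
      linarith)
  have hyb := Metric.closedBall_subset_ball hrR hy
  refine ⟨z y, ?_, ?_, ?_⟩
  · rw [hexpz y hyb, Complex.exp_add, hexp, one_mul, hexps y hyb]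
    exact hy0
  · linarith [hz y hyb]
  · rw [hexpz y hyb, add_sub_cancel_left]
    rw [div_le_iff₀ ha0] at hS
    linarith [hs y hyb]

/-- The equation `p(w, exp (exp w)) = 0` has a solution for which `w` is closer to the real axis
and `exp w` closer to the imaginary one. -/
lemma exists_zero_two_iterations (p : MvPolynomial (Fin 2) ℂ) (hirr : Irreducible p)
    (hx : degreeOf 0 p ≠ 0) (hy : degreeOf 1 p ≠ 0) :
    ∃ w : ℂ, eval ![w, Complex.exp (Complex.exp w)] p = 0 ∧ |w.im| < |w.re| ∧
      |(Complex.exp w).re| < |(Complex.exp w).im| := by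
  obtain ⟨d, hd, c, hc, R, hfac⟩ := exists_factorization p hirr hx hy
  obtain ⟨M, hM⟩ := p.exists_norm_eval_le_pow
  obtain ⟨N, hN⟩ := p.exists_norm_eval_sub_eval_le
  have hev : ∀ᶠ t : ℝ in Filter.atTop, R ≤ t ∧ 4 ≤ t ∧ c⁻¹ ≤ 2 * t ∧ 8 * 6 ^ d ≤ 2 * t ∧
      8 * ((2 * t) ^ (M + N + 3)) ^ (N + d + 2) < Real.exp t := by
    have h1 := (Real.tendsto_pow_mul_exp_neg_atTop_nhds_zero
      ((M + N + 3) * (N + d + 2))).const_mul (8 * 2 ^ ((M + N + 3) * (N + d + 2)))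
    rw [mul_zero] at h1
    filter_upwards [Filter.eventually_ge_atTop R, Filter.eventually_ge_atTop 4,
      Filter.eventually_ge_atTop c⁻¹, Filter.eventually_ge_atTop (8 * 6 ^ d),
      h1.eventually_lt_const one_pos] with t h1 h2 h3 h4 h5
    refine ⟨h1, h2, by linarith, by linarith, ?_⟩
    rw [Real.exp_neg, ← mul_assoc, ← div_eq_mul_inv, div_lt_one (Real.exp_pos t)] at h5
    rwa [← pow_mul, mul_pow, ← mul_assoc]
  have htend : Filter.Tendsto (fun k : ℕ => Real.log (2 * Real.pi * k)) Filter.atTop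
      Filter.atTop :=
    Real.tendsto_log_atTop.comp
      (tendsto_natCast_atTop_atTop.const_mul_atTop Real.two_pi_pos)
  obtain ⟨k, hk, hk0⟩ := ((htend.eventually hev).and (Filter.eventually_gt_atTop 0)).exists
  have hkpos : 0 < 2 * Real.pi * k := mul_pos Real.two_pi_pos (Nat.cast_pos.mpr hk0)
  obtain ⟨t, ht⟩ : ∃ t, t = Real.log (2 * Real.pi * k) := ⟨_, rfl⟩
  rw [← ht] at hk
  obtain ⟨hRt, h4t, hct, hdt, hbig⟩ := hk
  have hexpt : Real.exp t = 2 * Real.pi * k := by rw [ht, Real.exp_log hkpos]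
  obtain ⟨T, hT⟩ : ∃ T, T = 2 * t := ⟨_, rfl⟩
  rw [← hT] at hct hdt hbig
  have hT8 : 8 ≤ T := by linarith
  have hT0 : 0 < T := by linarith
  have hT1 : 1 ≤ T := by linarith
  set x : ℂ := t + (Real.pi / 2 : ℝ) * Complex.I with hxdef
  have hxre : x.re = t := by simp [hxdef]
  have hxim : x.im = Real.pi / 2 := by simp [hxdef]
  have hexpx : Complex.exp x = (2 * Real.pi * k : ℝ) * Complex.I := by
    rw [hxdef, Complex.exp_add, ← Complex.ofReal_exp, hexpt]
    congr 1
    push_cast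
    exact Complex.exp_pi_div_two_mul_I
  have hnexp : ‖Complex.exp x‖ = Real.exp t := by
    rw [Complex.norm_exp, hxre]
  have hexp1 : Complex.exp (Complex.exp x) = 1 := by
    rw [hexpx, Complex.exp_eq_one_iff]
    exact ⟨k, by push_cast; ring⟩
  have hpi := Real.pi_lt_d2
  have hpi0 := Real.pi_pos
  have hxT : ‖x‖ ≤ T := by
    have := Complex.norm_le_abs_re_add_abs_im x
    rw [hxre, hxim, abs_of_pos (by linarith), abs_of_pos (by linarith)] at this
    linarith
  have hRx : R ≤ ‖x‖ := hRt.trans (hxre ▸ Complex.re_le_norm x)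
  obtain ⟨h0, l, s, hl, hs, hprod⟩ := hfac x hRx
  have hcT : T⁻¹ ≤ c := inv_le_of_inv_le₀ hc hct
  have h0T : ‖eval ![x, 0] p‖ ≤ T ^ M := hM T (by linarith) _ fun i => by
    fin_cases i
    · simpa
    · simp; linarith
  -- a root of moderate size
  obtain ⟨y₀, hy₀s, hy₀lt⟩ : ∃ y ∈ s, ‖y‖ < T ^ (M + 2) := by
    by_contra! hcon
    have h1 := Multiset.pow_card_le_norm_prod_sub (y := 0) (B := T ^ (M + 2)) (by positivity)
      (fun r hr => by simpa using hcon r hr)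
    rw [hs] at h1
    have h2 : T ^ (M + 2) ≤ (T ^ (M + 2)) ^ d := le_self_pow₀ (one_le_pow₀ hT1) hd
    have h3 : T⁻¹ * T ^ (M + 2) ≤ ‖eval ![x, 0] p‖ := by
      rw [hprod, norm_mul]
      exact mul_le_mul (hcT.trans hl) (h2.trans h1) (by positivity) (norm_nonneg _)
    have h4 : T⁻¹ * T ^ (M + 2) = T ^ M * T := by
      field_simp
      ring
    have h5 : 0 < T ^ M := by positivity
    nlinarith
  have hroot : eval ![x, y₀] p = 0 := by
    rw [hprod, Multiset.prod_eq_zero (Multiset.mem_map.mpr ⟨y₀, hy₀s, sub_self _⟩), mul_zero]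
  obtain ⟨K, hK⟩ : ∃ K, K = M + N + 2 := ⟨_, rfl⟩
  have hTK1 : 1 ≤ T ^ K := one_le_pow₀ hT1
  have hyK : ‖y₀‖ ≤ T ^ K := hy₀lt.le.trans (pow_le_pow_right₀ hT1 (by omega))
  have hyK' : (T ^ K)⁻¹ ≤ ‖y₀‖ := by
    by_cases hyT : ‖y₀‖ ≤ T
    · have h1 := hN T (by linarith) ![x, 0] ![x, y₀]
        (fun i => by fin_cases i <;> simp <;> linarith) (fun i => by fin_cases i <;> simpa)
      have h2 : ‖(![x, 0] : Fin 2 → ℂ) - ![x, y₀]‖ ≤ ‖y₀‖ :=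
        (pi_norm_le_iff_of_nonneg (norm_nonneg _)).mpr fun i => by fin_cases i <;> simp
      rw [hroot, sub_zero] at h1
      have h3 : T⁻¹ ≤ T ^ N * ‖y₀‖ :=
        (hcT.trans h0).trans (h1.trans (mul_le_mul_of_nonneg_left h2 (by positivity)))
      rw [inv_le_iff_one_le_mul₀ hT0] at h3
      rw [inv_le_iff_one_le_mul₀ (by positivity)]
      have h4 : T ^ (N + 1) ≤ T ^ K := pow_le_pow_right₀ hT1 (by omega)
      calc 1 ≤ T ^ N * ‖y₀‖ * T := h3
        _ = ‖y₀‖ * T ^ (N + 1) := by ring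
        _ ≤ ‖y₀‖ * T ^ K := by gcongr
    · exact (inv_le_one_of_one_le₀ hTK1).trans (by linarith)
  have hy₀ : 0 < ‖y₀‖ := lt_of_lt_of_le (by positivity) hyK'
  obtain ⟨S, hS⟩ : ∃ S, S = T ^ (K + 1) := ⟨_, rfl⟩
  have hS8 : 8 * T ^ K ≤ S := by rw [hS, pow_succ]; nlinarith
  have hTS : T ≤ T ^ K := le_self_pow₀ hT1 (by omega)
  have hS1 : 1 ≤ S := by linarith
  rw [show T ^ (M + N + 3) = S by rw [hS, hK]] at hbig
  -- a circle on which `p(x, ·)` is not small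
  obtain ⟨ρ, hρ, hgap⟩ := exists_mem_Icc_forall_le_abs_sub
    (s.map fun r => ‖r - y₀‖ / ‖y₀‖) (1 / 8) (1 / 4) (by norm_num)
  rw [Multiset.card_map, hs] at hgap
  have hgapT : T⁻¹ ≤ (1 / 4 - 1 / 8) / 6 ^ d := by
    rw [inv_le_comm₀ hT0 (by positivity)]
    refine le_trans (le_of_eq ?_) hdt
    field_simp
    norm_num
  have hlow : ∀ y, ‖y - y₀‖ = ρ * ‖y₀‖ → (S ^ (d + 1))⁻¹ ≤ ‖eval ![x, y] p‖ := fun y hy => by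
    have hfar : ∀ r ∈ s, S⁻¹ ≤ ‖y - r‖ := fun r hr => by
      have h1 := hgapT.trans (hgap _ (Multiset.mem_map_of_mem _ hr))
      have h2 := abs_norm_sub_norm_le (y - y₀) (r - y₀)
      rw [sub_sub_sub_cancel_right, hy] at h2
      calc S⁻¹ = T⁻¹ * (T ^ K)⁻¹ := by rw [hS, pow_succ, mul_inv, mul_comm]
        _ ≤ |ρ - ‖r - y₀‖ / ‖y₀‖| * ‖y₀‖ := by gcongr
        _ = |ρ * ‖y₀‖ - ‖r - y₀‖| := by
            rw [← abs_of_pos hy₀, ← abs_mul, abs_of_pos hy₀]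
            congr 1
            field_simp
        _ ≤ _ := h2
    have h1 := Multiset.pow_card_le_norm_prod_sub (by positivity) hfar
    have h2 : S⁻¹ ≤ T⁻¹ := inv_anti₀ hT0 (by linarith)
    rw [hs] at h1
    rw [hprod, norm_mul, ← inv_pow, pow_succ']
    exact mul_le_mul ((h2.trans hcT).trans hl) h1 (by positivity) (norm_nonneg _)
  have hlog : ‖Complex.log y₀‖ ≤ T ^ K + Real.pi := by
    refine (Complex.norm_le_abs_re_add_abs_im _).trans (add_le_add ?_ ?_)
    · rw [Complex.log_re, abs_le]
      constructor
      · have h1 := Real.log_le_self (inv_nonneg.mpr hy₀.le)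
        rw [Real.log_inv] at h1
        linarith [inv_le_of_inv_le₀ (by positivity) hyK']
      · exact (Real.log_le_self hy₀.le).trans hyK
    · rw [Complex.log_im]
      exact Complex.abs_arg_le_pi y₀
  have hSN : S ≤ S ^ (N + d + 2) := le_self_pow₀ hS1 (by omega)
  obtain ⟨w, hw, hwx, hwe⟩ := exists_zero_of_approximate_zero p (S := S) (M := N)
    (hN S (by linarith)) hexp1 (norm_pos_iff.mp hy₀) hroot (by linarith) (by linarith)
    (by linarith) (by linarith [hρ.1]) (by linarith [hρ.2]) hlow
    (by rw [hnexp, div_le_iff₀ (Real.exp_pos t)]; linarith)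
    (by
      rw [hnexp, lt_inv_comm₀ (by positivity) (by positivity)]
      rw [show 4 * (S ^ N * (2 * (S / Real.exp t))) = 8 * S ^ (N + 1) / Real.exp t by ring,
        inv_div, lt_div_iff₀ (by positivity)]
      calc _ = 8 * S ^ (N + d + 2) := by ring
        _ < _ := hbig)
  refine ⟨w, hw, ?_, ?_⟩
  · have h1 := (Complex.abs_re_le_norm (w - x)).trans hwx
    have h2 := (Complex.abs_im_le_norm (w - x)).trans hwx
    rw [Complex.sub_re, hxre, abs_le] at h1
    rw [Complex.sub_im, hxim, abs_le] at h2
    refine lt_of_lt_of_le (abs_lt.mpr ⟨?_, ?_⟩) (le_abs_self _) <;> linarith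
  · have h1 := (Complex.abs_re_le_norm _).trans hwe
    have h2 := (Complex.abs_im_le_norm _).trans hwe
    rw [hnexp, Complex.sub_re, hexpx, Complex.re_ofReal_mul, Complex.I_re, mul_zero, sub_zero] at h1
    rw [hnexp, Complex.sub_im, hexpx, Complex.im_ofReal_mul, Complex.I_im, mul_one, ← hexpt,
      abs_le] at h2
    have := Real.exp_pos t
    refine lt_of_le_of_lt h1 (lt_of_lt_of_le ?_ (le_abs_self _))
    linarith

lemma linearIndependent_of_abs_lt {w u : ℂ} (hw : |w.im| < |w.re|) (hu : |u.re| < |u.im|) :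
    LinearIndependent ℚ ![w, u] := by
  refine LinearIndependent.pair_iff.mpr fun a b hab => ?_
  have hre := congrArg Complex.re hab
  have him := congrArg Complex.im hab
  simp only [Rat.smul_def, Complex.add_re, Complex.add_im, Complex.zero_re, Complex.zero_im]
    at hre him
  rw [← Complex.ofReal_ratCast, ← Complex.ofReal_ratCast, Complex.re_ofReal_mul,
    Complex.re_ofReal_mul] at hre
  rw [← Complex.ofReal_ratCast, ← Complex.ofReal_ratCast, Complex.im_ofReal_mul,
    Complex.im_ofReal_mul] at him
  have hre' : |(a : ℝ)| * |w.re| = |(b : ℝ)| * |u.re| := by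
    rw [← abs_mul, ← abs_mul, eq_neg_of_add_eq_zero_left hre, abs_neg]
  have him' : |(a : ℝ)| * |w.im| = |(b : ℝ)| * |u.im| := by
    rw [← abs_mul, ← abs_mul, eq_neg_of_add_eq_zero_left him, abs_neg]
  have ha := mul_nonneg (abs_nonneg (a : ℝ)) (sub_pos.mpr hw).le
  have hb := mul_nonneg (abs_nonneg (b : ℝ)) (sub_pos.mpr hu).le
  have ha' : |(a : ℝ)| * (|w.re| - |w.im|) = 0 := by linarith
  have hb' : |(b : ℝ)| * (|u.im| - |u.re|) = 0 := by linarith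
  constructor
  · simpa [(sub_pos.mpr hw).ne'] using ha'
  · simpa [(sub_pos.mpr hu).ne'] using hb'

/-- A point on an algebraic hypersurface defined over the algebraic numbers has algebraically
dependent coordinates. -/
lemma not_algebraicIndependent_of_eval_eq_zero {σ : Type*} {p : MvPolynomial σ ℂ}
    (hcoeff : ∀ mo : σ →₀ ℕ, IsAlgebraic ℚ (coeff mo p)) (hp : p ≠ 0) {v : σ → ℂ}
    (hv : eval v p = 0) : ¬ AlgebraicIndependent ℚ v := by
  intro h
  have h' : AlgebraicIndependent (algebraicClosure ℚ ℂ) v := by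
    have : Algebra.IsAlgebraic ℚ (algebraicClosure ℚ ℂ) := algebraicClosure.isAlgebraic ℚ ℂ
    exact h.extendScalars _
  obtain ⟨q, rfl⟩ : p ∈ Set.range (map (algebraMap (algebraicClosure ℚ ℂ) ℂ)) := by
    rw [mem_range_map_iff_coeffs_subset]
    intro a ha
    obtain ⟨mo, _, rfl⟩ := mem_coeffs_iff.mp ha
    exact ⟨⟨_, mem_algebraicClosure_iff.mpr (hcoeff mo)⟩, rfl⟩
  rw [eval_map] at hv
  rw [algebraicIndependent_iff.mp h' q hv, map_zero] at hp
  exact hp rfl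

/-- (SC) For a nonzero irreducible `p ∈ ℚ^alg[x,y]` depending on both
variables, there is `w ∈ ℂ` with `p(w, e^{e^w}) = 0` which is generic:
`td_ℚ(w, e^w, e^{e^w}) = 2`. -/
theorem generic_solution_two_iterations
    (hSC : SchanuelConjecture) (p : MvPolynomial (Fin 2) ℂ)
    (hcoeff : ∀ mo : Fin 2 →₀ ℕ, IsAlgebraic ℚ (MvPolynomial.coeff mo p))
    (hp0 : p ≠ 0) (hirr : Irreducible p)
    (hx : MvPolynomial.degreeOf 0 p ≠ 0) (hy : MvPolynomial.degreeOf 1 p ≠ 0) :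
    ∃ w : ℂ, MvPolynomial.eval ![w, Complex.exp (Complex.exp w)] p = 0 ∧
      HasTrdeg ({w, Complex.exp w, Complex.exp (Complex.exp w)} : Set ℂ) 2 := by
  obtain ⟨w, hw, him, hre⟩ := exists_zero_two_iterations p hirr hx hy
  refine ⟨w, hw, ?_, fun e g hg hind => ?_⟩
  · obtain ⟨f, hf, hind⟩ := hSC 2 _ (linearIndependent_of_abs_lt him hre)
    refine ⟨f, fun i => ?_, hind⟩
    rcases hf i with ⟨j, hj⟩ | ⟨j, hj⟩ <;> rw [← hj] <;> fin_cases j <;> simp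
  · by_contra! he
    have hsub : Set.range g ⊆ {w, Complex.exp w, Complex.exp (Complex.exp w)} :=
      Set.range_subset_iff.mpr hg
    have hcard : (Set.range g).ncard = e := by
      rw [← Set.image_univ, Set.ncard_image_of_injective _ hind.injective, Set.ncard_univ,
        Nat.card_fin]
    have hthree : ({w, Complex.exp w, Complex.exp (Complex.exp w)} : Set ℂ).ncard ≤ 3 := by
      refine (Set.ncard_insert_le _ _).trans (Nat.succ_le_succ ?_)
      exact (Set.ncard_insert_le _ _).trans (by rw [Set.ncard_singleton])
    have hrange := Set.eq_of_subset_of_ncard_le hsub (by omega) (Set.toFinite _)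
    obtain ⟨i, hi⟩ : w ∈ Set.range g := by rw [hrange]; simp
    obtain ⟨j, hj⟩ : Complex.exp (Complex.exp w) ∈ Set.range g := by rw [hrange]; simp
    have hij : i ≠ j := by
      rintro rfl
      rw [← hj, hi, Set.pair_comm, Set.insert_idem] at hrange
      rw [hrange] at hcard
      have := Set.ncard_insert_le w {Complex.exp w}
      rw [Set.ncard_singleton] at this
      omega
    refine not_algebraicIndependent_of_eval_eq_zero hcoeff hp0 hw ?_
    have hinj : Function.Injective ![i, j] := by
      intro a b hab
      fin_cases a <;> fin_cases b <;> simp_all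
    convert hind.comp _ hinj using 1
    ext a
    fin_cases a <;> simp [hi, hj]
end

section
/- Assume Schanuel's Conjecture. Let p(x,y,z) ∈ ℚ^alg[x,y,z] be a nonzero irreducible polynomial depending on x and z. Then there exists a ∈ ℂ such that p(a, e^a, e^{e^a}) = 0 and td_ℚ(a, e^a, e^{e^a}) = 2. -/
open MvPolynomial

section

open Filter Topology Metric

/-- A property holding along `l × 𝓝 y` for every `y` in a compact set `K` eventually holds
uniformly on `K`. -/
theorem IsCompact.eventually_forall_of_forall_eventually_prod {α Y : Type*} [TopologicalSpace Y]
    {l : Filter α} {K : Set Y} (hK : IsCompact K) {P : α → Y → Prop}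
    (hP : ∀ y ∈ K, ∀ᶠ z : α × Y in l ×ˢ 𝓝 y, P z.1 z.2) :
    ∀ᶠ a in l, ∀ y ∈ K, P a y := by
  simp only [← eventually_iSup, ← hK.prod_nhdsSet_eq_biSup] at hP
  exact hP.curry.mono fun _ h ↦ h.self_of_nhdsSet

/-- **Hurwitz's theorem**: if holomorphic functions converge continuously to `g` on a closed
disc, and `g` vanishes at the centre but not on the boundary circle, then the approximating
functions eventually have zeros in the disc. -/
theorem eventually_exists_zero_of_tendsto {f : ℕ → ℂ → ℂ} {g : ℂ → ℂ} {c : ℂ} {r : ℝ}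
    (hr : 0 < r) (hg : Continuous g) (hgc : g c = 0) (hgs : ∀ u ∈ sphere c r, g u ≠ 0)
    (hf : ∀ᶠ n in atTop, DiffContOnCl ℂ (f n) (ball c r))
    (hlim : ∀ u ∈ closedBall c r,
      Tendsto (fun q : ℕ × ℂ ↦ f q.1 q.2) (atTop ×ˢ 𝓝 u) (𝓝 (g u))) :
    ∀ᶠ n in atTop, ∃ u ∈ closedBall c r, f n u = 0 := by
  obtain ⟨v, hv, hmin⟩ := (isCompact_sphere c r).exists_isMinOn
    (NormedSpace.sphere_nonempty.2 hr.le) hg.norm.continuousOn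
  set ε := ‖g v‖ with hε
  have hεpos : 0 < ε := norm_pos_iff.2 (hgs v hv)
  have hclose : ∀ᶠ n in atTop, ∀ u ∈ closedBall c r, ‖f n u - g u‖ < ε / 4 := by
    refine (isCompact_closedBall c r).eventually_forall_of_forall_eventually_prod fun u hu ↦ ?_
    have h : Tendsto (fun q : ℕ × ℂ ↦ ‖f q.1 q.2 - g q.2‖) (atTop ×ˢ 𝓝 u) (𝓝 0) := by
      simpa using ((hlim u hu).sub ((hg.tendsto u).comp tendsto_snd)).norm
    exact h.eventually (gt_mem_nhds (by positivity))
  filter_upwards [hf, hclose] with n hn hcl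
  have hc : ‖f n c‖ < ε / 4 := by simpa [hgc] using hcl c (mem_closedBall_self hr.le)
  have hsph : ∀ z ∈ sphere c r, ε / 2 ≤ ‖f n z - f n c‖ := fun z hz ↦ by
    have h1 := hcl z (sphere_subset_closedBall hz)
    have h2 : ε ≤ ‖g z‖ := hmin hz
    have h3 : ‖g z‖ ≤ ‖f n z - f n c‖ + ‖f n c‖ + ‖f n z - g z‖ := by
      calc ‖g z‖ = ‖(f n z - f n c) + f n c - (f n z - g z)‖ := by congr 1; ring
        _ ≤ _ := (norm_sub_le _ _).trans (by gcongr; exact norm_add_le _ _)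
    linarith
  have hfreq : ∃ᶠ z in 𝓝 c, f n z ≠ f n c := by
    intro hcon
    have hcon' : ∀ᶠ z in 𝓝 c, f n z = f n c := by simpa using hcon
    have heq : Set.EqOn (f n) (fun _ ↦ f n c) (ball c r) :=
      (hn.differentiableOn.analyticOnNhd isOpen_ball).eqOn_of_preconnected_of_eventuallyEq
        analyticOnNhd_const (convex_ball c r).isPreconnected (mem_ball_self hr) hcon'
    have heq' : Set.EqOn (f n) (fun _ ↦ f n c) (closedBall c r) :=
      heq.of_subset_closure (by simpa [closure_ball c hr.ne'] using hn.continuousOn)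
        continuousOn_const ball_subset_closedBall (closure_ball c hr.ne').ge
    have := hsph v hv
    rw [heq' (sphere_subset_closedBall hv)] at this
    simp at this
    linarith
  have h0 : (0 : ℂ) ∈ ball (f n c) (ε / 2 / 2) := by
    rw [mem_ball, dist_zero_left]; linarith
  exact hn.ball_subset_image_closedBall hr hsph hfreq h0

/-- A polynomial in `exp` with nonzero constant term and positive degree has an isolated zero. -/
theorem Polynomial.exists_isolated_zero_eval_exp {Q : Polynomial ℂ} (h0 : Q.coeff 0 ≠ 0)
    {k : ℕ} (hk : k ≠ 0) (hQk : Q.coeff k ≠ 0) :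
    ∃ (c : ℂ) (r : ℝ), 0 < r ∧ Q.eval (Complex.exp c) = 0 ∧
      ∀ u ∈ sphere c r, Q.eval (Complex.exp u) ≠ 0 := by
  have hQ : Q ≠ 0 := by rintro rfl; simp at h0
  have hdeg : Q.degree ≠ 0 := fun h ↦ by
    have h1 := Polynomial.le_degree_of_ne_zero hQk
    rw [h] at h1
    exact hk (Nat.le_zero.1 (by exact_mod_cast h1))
  obtain ⟨w, hw⟩ := Complex.isAlgClosed.exists_root Q hdeg
  have hw0 : w ≠ 0 := by
    rintro rfl
    exact h0 (by rw [Polynomial.coeff_zero_eq_eval_zero]; exact hw)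
  have hev : ∀ᶠ z in 𝓝[≠] w, Q.eval z ≠ 0 := by
    have h1 : ((Q.rootSet ℂ) \ {w})ᶜ ∈ 𝓝 w :=
      ((Q.rootSet_finite ℂ).subset Set.sdiff_subset).isClosed.isOpen_compl.mem_nhds (by simp)
    filter_upwards [nhdsWithin_le_nhds h1, self_mem_nhdsWithin] with z hz hzw hz0
    refine hz ⟨?_, hzw⟩
    simpa [Polynomial.mem_rootSet, hQ] using hz0
  have hexp := ((Complex.hasDerivAt_exp (Complex.log w)).tendsto_nhdsNE
    (Complex.exp_ne_zero _))
  rw [Complex.exp_log hw0] at hexp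
  have hev' := hexp.eventually hev
  rw [eventually_nhdsWithin_iff, Metric.eventually_nhds_iff] at hev'
  obtain ⟨δ, hδ, H⟩ := hev'
  refine ⟨Complex.log w, δ / 2, by positivity, by rw [Complex.exp_log hw0]; exact hw, ?_⟩
  intro u hu
  rw [mem_sphere] at hu
  refine H (by linarith) ?_
  rintro rfl
  simp at hu
  linarith

/-- An irreducible polynomial involving the variable `i` has a monomial free of any other given
variable `j`. -/
theorem MvPolynomial.exists_mem_support_apply_eq_zero {σ F : Type*} [Field F]
    {p : MvPolynomial σ F} (hirr : Irreducible p) {i j : σ} (hij : i ≠ j)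
    (hi : degreeOf i p ≠ 0) : ∃ m ∈ p.support, m j = 0 := by
  classical
  by_contra! hcon
  have hdvd : X j ∣ p := by
    rw [X_dvd_iff_modMonomial_eq_zero]
    ext d
    by_cases hd : Finsupp.single j 1 ≤ d
    · rw [coeff_modMonomial_of_le _ hd, coeff_zero]
    · rw [coeff_modMonomial_of_not_le _ hd, coeff_zero]
      by_contra hne
      exact hd (by
        rw [Finsupp.single_le_iff]
        exact Nat.one_le_iff_ne_zero.2 (hcon d (mem_support_iff.2 hne)))
  obtain ⟨q, rfl⟩ := hdvd
  rcases hirr.isUnit_or_isUnit rfl with h | h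
  · exact (X_prime (R := F) (i := j)).not_isUnit h
  · obtain ⟨c, -, rfl⟩ := (isUnit_iff_eq_C_of_isReduced).1 h
    apply hi
    have h1 := degreeOf_mul_le i (X j : MvPolynomial σ F) (C c)
    rw [degreeOf_X_of_ne hij, degreeOf_C] at h1
    omega

/-- A polynomial with algebraic coefficients that vanishes at an algebraically independent tuple
is zero. -/
theorem AlgebraicIndependent.eq_zero_of_isAlgebraic_coeff {ι F E : Type*} [Field F] [Field E]
    [Algebra F E] {v : ι → E} (hv : AlgebraicIndependent F v) {p : MvPolynomial ι E}
    (hp : ∀ m, IsAlgebraic F (coeff m p)) (h : eval v p = 0) : p = 0 := by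
  have hmem : p ∈ Set.range (MvPolynomial.map (σ := ι)
      (algebraMap (algebraicClosure F E) E)) := by
    have := (MvPolynomial.mem_range_map_iff_coeffs_subset
      (f := algebraMap (algebraicClosure F E) E) (x := p)).2 (by
        intro c hc
        obtain ⟨m, -, rfl⟩ := MvPolynomial.mem_coeffs_iff.1 hc
        exact ⟨⟨_, mem_algebraicClosure_iff.2 (hp m)⟩, rfl⟩)
    exact this
  obtain ⟨q, rfl⟩ := hmem
  have hq : MvPolynomial.aeval v q = 0 := by
    rw [MvPolynomial.aeval_def, ← MvPolynomial.eval_map]; exact h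
  rw [(algebraicIndependent_iff.1 hv.algebraicClosure) q hq, map_zero]

/-- A tuple of three numbers satisfying a nontrivial relation with algebraic coefficients contains
at most two algebraically independent elements. -/
theorem le_two_of_algebraicIndependent {v : Fin 3 → ℂ} {p : MvPolynomial (Fin 3) ℂ}
    (hp : ∀ m, IsAlgebraic ℚ (coeff m p)) (hp0 : p ≠ 0) (h : eval v p = 0)
    {e : ℕ} {g : Fin e → ℂ} (hg : ∀ i, g i ∈ Set.range v) (hind : AlgebraicIndependent ℚ g) :
    e ≤ 2 := by
  by_contra! he
  choose k hk using hg
  let ι : Fin 3 → Fin e := Fin.castLE he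
  have hinj : Function.Injective (k ∘ ι) := fun a b hab ↦ by
    have h1 : g (ι a) = g (ι b) := by rw [← hk, ← hk]; exact congrArg v hab
    exact Fin.castLE_injective he (hind.injective h1)
  let σ : Fin 3 ≃ Fin 3 := Equiv.ofBijective _ (Finite.injective_iff_bijective.1 hinj)
  have hv : v = g ∘ (ι ∘ σ.symm) := by
    funext i
    have h1 : k (ι (σ.symm i)) = i := σ.apply_symm_apply i
    simp only [Function.comp_apply]
    rw [← hk, h1]
  have hvind : AlgebraicIndependent ℚ v := by
    rw [hv]
    exact hind.comp _ ((Fin.castLE_injective he).comp σ.symm.injective)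
  exact hp0 (hvind.eq_zero_of_isAlgebraic_coeff hp h)

/-- Complex numbers spanning a parallelogram of nonzero area are linearly independent. -/
theorem Complex.linearIndependent_pair_rat {x y : ℂ} (h : x.re * y.im ≠ x.im * y.re) :
    LinearIndependent ℚ ![x, y] := by
  rw [LinearIndependent.pair_iff]
  intro s t hst
  have hre : (s : ℝ) * x.re + t * y.re = 0 := by
    simpa [Rat.smul_def] using congrArg Complex.re hst
  have him : (s : ℝ) * x.im + t * y.im = 0 := by
    simpa [Rat.smul_def] using congrArg Complex.im hst
  have hd := sub_ne_zero.2 h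
  have hs : (s : ℝ) * (x.re * y.im - x.im * y.re) = 0 := by
    linear_combination y.im * hre - y.re * him
  have ht : (t : ℝ) * (x.re * y.im - x.im * y.re) = 0 := by
    linear_combination x.re * him - x.im * hre
  exact ⟨by simpa [hd] using hs, by simpa [hd] using ht⟩

/-- If a finite set of monomials in `x, y, z` contains one free of `z` and one involving `z`, then
for suitable `s` the weight `deg_x + K deg_y + s deg_z` attains its maximum at monomials of both
kinds. -/
theorem exists_weight_max (S : Finset (Fin 3 →₀ ℕ)) (K : ℝ) (h0 : ∃ m ∈ S, m 2 = 0)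
    (h1 : ∃ m ∈ S, m 2 ≠ 0) :
    ∃ s M : ℝ, (∀ m ∈ S, (m 0 : ℝ) + K * m 1 + s * m 2 ≤ M) ∧
      (∃ m ∈ S, m 2 = 0 ∧ (m 0 : ℝ) + K * m 1 + s * m 2 = M) ∧
      ∃ m ∈ S, m 2 ≠ 0 ∧ (m 0 : ℝ) + K * m 1 + s * m 2 = M := by
  let v : (Fin 3 →₀ ℕ) → ℝ := fun m ↦ m 0 + K * m 1
  obtain ⟨a, ha, hamax⟩ := (S.filter fun m ↦ m 2 = 0).exists_max_image v
    (by obtain ⟨m, hm⟩ := h0; exact ⟨m, Finset.mem_filter.2 hm⟩)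
  obtain ⟨b, hb, hbmin⟩ := (S.filter fun m ↦ m 2 ≠ 0).exists_min_image
    (fun m ↦ (v a - v m) / m 2) (by obtain ⟨m, hm⟩ := h1; exact ⟨m, Finset.mem_filter.2 hm⟩)
  rw [Finset.mem_filter] at ha hb
  have hb' : (b 2 : ℝ) ≠ 0 := by exact_mod_cast hb.2
  refine ⟨(v a - v b) / b 2, v a, fun m hm ↦ ?_, ⟨a, ha.1, ha.2, by simp [ha.2, v]⟩,
    ⟨b, hb.1, hb.2, ?_⟩⟩
  · by_cases h : m 2 = 0
    · simpa [h, v] using hamax m (Finset.mem_filter.2 ⟨hm, h⟩)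
    · have h1 := hbmin m (Finset.mem_filter.2 ⟨hm, h⟩)
      have hpos : (0 : ℝ) < m 2 := by exact_mod_cast Nat.pos_of_ne_zero h
      rw [le_div_iff₀ hpos] at h1
      change v m + _ ≤ v a
      linarith
  · change v b + _ = v a
    field_simp
    ring

namespace ExpExpZero

variable (K : ℕ) (s : ℝ)

/-- The rescaled approximation to `e^a`. -/
noncomputable def Y (q : ℕ × ℂ) : ℂ :=
  2 * Real.pi * Complex.I + (s * Real.log q.1 + q.2) / (q.1 : ℂ) ^ K

/-- The candidate zero. -/
noncomputable def x (q : ℕ × ℂ) : ℂ :=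
  2 * Real.pi * Complex.I * q.1 + K * Real.log q.1 + Complex.log (Y K s q)

variable {K s}

theorem exp_log_natCast {n : ℕ} (hn : n ≠ 0) : Complex.exp (Real.log n : ℝ) = n := by
  rw [← Complex.ofReal_exp, Real.exp_log (by positivity)]; simp

theorem exp_x {q : ℕ × ℂ} (hq : q.1 ≠ 0) (hY : Y K s q ≠ 0) :
    Complex.exp (x K s q) = (q.1 : ℂ) ^ K * Y K s q := by
  rw [x, Complex.exp_add, Complex.exp_add, Complex.exp_log hY, Complex.exp_nat_mul,
    exp_log_natCast hq, mul_comm _ (q.1 : ℂ), Complex.exp_nat_mul_two_pi_mul_I, one_mul]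

theorem pow_mul_Y {q : ℕ × ℂ} (hq : q.1 ≠ 0) :
    (q.1 : ℂ) ^ K * Y K s q =
      (q.1 ^ K : ℕ) * (2 * Real.pi * Complex.I) + (s * Real.log q.1 + q.2) := by
  have : (q.1 : ℂ) ≠ 0 := by exact_mod_cast hq
  rw [Y]
  push_cast
  field_simp

theorem exp_pow_mul_Y {q : ℕ × ℂ} (hq : q.1 ≠ 0) :
    Complex.exp ((q.1 : ℂ) ^ K * Y K s q) =
      Complex.exp (s * Real.log q.1) * Complex.exp q.2 := by
  rw [pow_mul_Y hq, Complex.exp_add, Complex.exp_nat_mul_two_pi_mul_I, one_mul, Complex.exp_add]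

theorem tendsto_log_natCast_fst (u : ℂ) :
    Tendsto (fun q : ℕ × ℂ ↦ Real.log q.1) (atTop ×ˢ 𝓝 u) atTop :=
  Real.tendsto_log_atTop.comp (tendsto_natCast_atTop_atTop.comp tendsto_fst)

theorem tendsto_natCast_inv_fst (u : ℂ) :
    Tendsto (fun q : ℕ × ℂ ↦ (q.1 : ℂ)⁻¹) (atTop ×ˢ 𝓝 u) (𝓝 0) :=
  (tendsto_inv_atTop_nhds_zero_nat (𝕜 := ℂ)).comp tendsto_fst

theorem tendsto_log_div_fst (u : ℂ) :
    Tendsto (fun q : ℕ × ℂ ↦ (Real.log q.1 : ℂ) * (q.1 : ℂ)⁻¹) (atTop ×ˢ 𝓝 u) (𝓝 0) := by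
  have h : Tendsto (fun n : ℕ ↦ Real.log n / n) atTop (𝓝 0) :=
    Real.isLittleO_log_id_atTop.tendsto_div_nhds_zero.comp tendsto_natCast_atTop_atTop
  have h2 := (Complex.continuous_ofReal.tendsto 0).comp (h.comp (tendsto_fst (g := 𝓝 u)))
  simpa [Function.comp_def, div_eq_mul_inv] using h2

theorem tendsto_linear_div_pow (s : ℝ) {k : ℕ} (hk : k ≠ 0) (u : ℂ) :
    Tendsto (fun q : ℕ × ℂ ↦ (s * Real.log q.1 + q.2) / (q.1 : ℂ) ^ k) (atTop ×ˢ 𝓝 u) (𝓝 0) := by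
  obtain ⟨j, rfl⟩ := Nat.exists_eq_succ_of_ne_zero hk
  have h1 : Tendsto (fun q : ℕ × ℂ ↦ (s * (Real.log q.1 * (q.1 : ℂ)⁻¹) + q.2 * (q.1 : ℂ)⁻¹) *
      ((q.1 : ℂ)⁻¹) ^ j) (atTop ×ˢ 𝓝 u) (𝓝 ((s * 0 + u * 0) * 0 ^ j)) :=
    (((tendsto_log_div_fst u).const_mul _).add
      (tendsto_snd.mul (tendsto_natCast_inv_fst u))).mul ((tendsto_natCast_inv_fst u).pow j)
  simp only [mul_zero, add_zero, zero_mul] at h1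
  refine h1.congr fun q ↦ ?_
  rw [Nat.succ_eq_add_one, pow_succ, div_eq_mul_inv, mul_inv, inv_pow]
  ring

theorem tendsto_Y (hK : K ≠ 0) (u : ℂ) :
    Tendsto (Y K s) (atTop ×ˢ 𝓝 u) (𝓝 (2 * Real.pi * Complex.I)) := by
  simpa only [add_zero] using! (tendsto_linear_div_pow s hK u).const_add (2 * Real.pi * Complex.I)

theorem two_pi_I_mem_slitPlane : (2 * Real.pi * Complex.I : ℂ) ∈ Complex.slitPlane :=
  Or.inr (by simp [Real.pi_ne_zero])

theorem tendsto_log_Y (hK : K ≠ 0) (u : ℂ) :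
    Tendsto (fun q ↦ Complex.log (Y K s q)) (atTop ×ˢ 𝓝 u)
      (𝓝 (Complex.log (2 * Real.pi * Complex.I))) :=
  (continuousAt_clog two_pi_I_mem_slitPlane).tendsto.comp (tendsto_Y hK u)

theorem eventually_fst_ne_zero (u : ℂ) : ∀ᶠ q : ℕ × ℂ in atTop ×ˢ 𝓝 u, q.1 ≠ 0 :=
  tendsto_fst.eventually (eventually_ne_atTop 0)

theorem tendsto_x_div (hK : K ≠ 0) (u : ℂ) :
    Tendsto (fun q ↦ x K s q / q.1) (atTop ×ˢ 𝓝 u) (𝓝 (2 * Real.pi * Complex.I)) := by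
  have h := (((tendsto_log_div_fst u).const_mul (K : ℂ)).add ((tendsto_log_Y (s := s) hK u).mul
    (tendsto_natCast_inv_fst u))).const_add (2 * Real.pi * Complex.I)
  simp only [mul_zero, add_zero] at h
  refine h.congr' ?_
  filter_upwards [eventually_fst_ne_zero u] with q hq
  have : (q.1 : ℂ) ≠ 0 := by exact_mod_cast hq
  rw [x]
  field_simp
  ring

theorem eventually_linearIndependent (hK : 2 ≤ K) (u : ℂ) :
    ∀ᶠ q in atTop ×ˢ 𝓝 u,
      LinearIndependent ℚ ![x K s q, (q.1 : ℂ) ^ K * Y K s q] := by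
  have hK0 : K ≠ 0 := by omega
  have hY : Tendsto (fun q ↦ (Y K s q).im) (atTop ×ˢ 𝓝 u) (𝓝 (2 * Real.pi)) := by
    simpa [Function.comp_def] using (Complex.continuous_im.tendsto _).comp (tendsto_Y (s := s) hK0 u)
  have hxre : Tendsto (fun q ↦ (x K s q).re) (atTop ×ˢ 𝓝 u) atTop := by
    have h1 := (tendsto_log_natCast_fst u).const_mul_atTop
      (show (0 : ℝ) < K by exact_mod_cast Nat.pos_of_ne_zero hK0)
    have h2 := (Complex.continuous_re.tendsto _).comp (tendsto_log_Y (s := s) hK0 u)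
    refine (h1.atTop_add h2).congr fun q ↦ ?_
    simp [x, -Complex.natCast_log]
  have hL : Tendsto (fun q ↦ (x K s q).re * (Y K s q).im) (atTop ×ˢ 𝓝 u) atTop :=
    hxre.atTop_mul_pos (by positivity) hY
  have hX : Tendsto (fun q ↦ (x K s q / q.1).im) (atTop ×ˢ 𝓝 u) (𝓝 (2 * Real.pi)) := by
    simpa [Function.comp_def] using (Complex.continuous_im.tendsto _).comp (tendsto_x_div (s := s) hK0 u)
  have hZ := (Complex.continuous_re.tendsto _).comp
    (tendsto_linear_div_pow s (k := K - 1) (by omega) u)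
  have hR := hX.mul hZ
  simp only [Complex.zero_re, mul_zero] at hR
  filter_upwards [hL.eventually_gt_atTop 1, hR.eventually (gt_mem_nhds one_pos),
    eventually_fst_ne_zero u] with q h1 h2 hq
  apply Complex.linearIndependent_pair_rat
  have hq' : (q.1 : ℝ) ≠ 0 := by exact_mod_cast hq
  have hqc : (q.1 : ℂ) ≠ 0 := by exact_mod_cast hq
  have hYre : (Y K s q).re * q.1 =
      ((s * Real.log q.1 + q.2) / (q.1 : ℂ) ^ (K - 1)).re := by
    obtain ⟨j, rfl⟩ : ∃ j, K = j + 1 := ⟨K - 1, by omega⟩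
    have : Y (j + 1) s q * (q.1 : ℝ) = (2 * Real.pi * q.1 : ℝ) * Complex.I +
        (s * Real.log q.1 + q.2) / (q.1 : ℂ) ^ j := by
      rw [Y]; push_cast; field_simp; ring
    rw [Nat.add_sub_cancel, ← Complex.re_mul_ofReal, this]
    simp
  have hXim : (x K s q).im = (x K s q / q.1).im * q.1 := by
    rw [← Complex.ofReal_natCast, Complex.div_ofReal_im]
    field_simp
  have hprod : (x K s q).im * (Y K s q).re < 1 := by
    rw [hXim, mul_assoc, mul_comm (q.1 : ℝ), hYre]; exact h2
  have hpow : (q.1 : ℂ) ^ K = ((q.1 ^ K : ℝ) : ℂ) := by push_cast; rfl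
  rw [hpow, Complex.re_ofReal_mul, Complex.im_ofReal_mul]
  intro heq
  have h3 : (q.1 : ℝ) ^ K * ((x K s q).re * (Y K s q).im - (x K s q).im * (Y K s q).re) = 0 := by
    linear_combination heq
  rcases mul_eq_zero.1 h3 with h | h
  · exact pow_ne_zero _ hq' h
  · linarith

/-- The polynomial `p` along the candidate zeros, divided by its expected size. -/
noncomputable def normalized (K : ℕ) (s M : ℝ) (p : MvPolynomial (Fin 3) ℂ) (q : ℕ × ℂ) : ℂ :=
  ∑ m ∈ p.support, coeff m p *
    (Complex.exp (((m 0 + K * m 1 + s * m 2 - M) * Real.log q.1 : ℝ)) *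
      ((x K s q / q.1) ^ m 0 * Y K s q ^ m 1 * Complex.exp q.2 ^ m 2))

/-- The limit of `normalized`, as a polynomial in the exponential of the parameter. -/
noncomputable def limitPoly (K : ℕ) (s M : ℝ) (p : MvPolynomial (Fin 3) ℂ) : Polynomial ℂ :=
  ∑ m ∈ p.support with (m 0 + K * m 1 + s * m 2 : ℝ) = M,
    Polynomial.monomial (m 2) (coeff m p * (2 * Real.pi * Complex.I) ^ (m 0 + m 1))

theorem eval_eq_normalized (M : ℝ) (p : MvPolynomial (Fin 3) ℂ) {q : ℕ × ℂ} (hq : q.1 ≠ 0)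
    (hY : Y K s q ≠ 0) :
    eval ![x K s q, Complex.exp (x K s q), Complex.exp (Complex.exp (x K s q))] p =
      Complex.exp ((M * Real.log q.1 : ℝ)) * normalized K s M p q := by
  rw [exp_x hq hY, exp_pow_mul_Y hq, MvPolynomial.eval_eq', normalized, Finset.mul_sum]
  refine Finset.sum_congr rfl fun m _ ↦ ?_
  have hqc : (q.1 : ℂ) ≠ 0 := by exact_mod_cast hq
  have hexp : Complex.exp ((M * Real.log q.1 : ℝ)) *
      Complex.exp (((m 0 + K * m 1 + s * m 2 - M) * Real.log q.1 : ℝ)) =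
      (q.1 : ℂ) ^ m 0 * ((q.1 : ℂ) ^ K) ^ m 1 * Complex.exp (s * Real.log q.1) ^ m 2 := by
    rw [← exp_log_natCast hq, ← Complex.exp_nat_mul, ← Complex.exp_nat_mul, ← Complex.exp_nat_mul,
      ← Complex.exp_nat_mul, ← Complex.exp_add, ← Complex.exp_add, ← Complex.exp_add]
    congr 1
    push_cast
    ring
  rw [Fin.prod_univ_three]
  simp only [Matrix.cons_val]
  rw [mul_left_comm (Complex.exp _), ← mul_assoc (Complex.exp _) (Complex.exp _), hexp, mul_pow,
    mul_pow, div_pow]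
  field_simp

theorem tendsto_normalized (hK : K ≠ 0) {M : ℝ} {p : MvPolynomial (Fin 3) ℂ}
    (hM : ∀ m ∈ p.support, (m 0 : ℝ) + K * m 1 + s * m 2 ≤ M) (u : ℂ) :
    Tendsto (normalized K s M p) (atTop ×ˢ 𝓝 u)
      (𝓝 ((limitPoly K s M p).eval (Complex.exp u))) := by
  rw [limitPoly, Finset.sum_filter, Polynomial.eval_finsetSum]
  refine tendsto_finsetSum _ fun m hm ↦ ?_
  have h1 : Tendsto (fun q : ℕ × ℂ ↦ (x K s q / q.1) ^ m 0 * Y K s q ^ m 1 *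
      Complex.exp q.2 ^ m 2) (atTop ×ˢ 𝓝 u)
      (𝓝 ((2 * Real.pi * Complex.I) ^ m 0 * (2 * Real.pi * Complex.I) ^ m 1 *
        Complex.exp u ^ m 2)) :=
    (((tendsto_x_div hK u).pow _).mul ((tendsto_Y hK u).pow _)).mul
      (((Complex.continuous_exp.tendsto u).comp tendsto_snd).pow _)
  split_ifs with h
  · simp only [h, sub_self, zero_mul, Complex.ofReal_zero, Complex.exp_zero, one_mul,
      Polynomial.eval_monomial]
    rw [mul_assoc, pow_add]
    exact h1.const_mul _
  · have hneg : (m 0 + K * m 1 + s * m 2 - M : ℝ) < 0 :=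
      sub_neg.2 (lt_of_le_of_ne (hM m hm) h)
    have h2 : Tendsto (fun q : ℕ × ℂ ↦
        Complex.exp (((m 0 + K * m 1 + s * m 2 - M) * Real.log q.1 : ℝ)))
        (atTop ×ˢ 𝓝 u) (𝓝 0) := by
      have h3 := Real.tendsto_exp_atBot.comp
        ((tendsto_log_natCast_fst u).const_mul_atTop_of_neg hneg)
      have h4 := (Complex.continuous_ofReal.tendsto 0).comp h3
      simpa only [Function.comp_def, Complex.ofReal_exp, Complex.ofReal_zero] using h4
    simpa using (h2.mul h1).const_mul (coeff m p)

theorem coeff_limitPoly_ne_zero {M : ℝ} {p : MvPolynomial (Fin 3) ℂ} (hK : degreeOf 0 p < K)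
    {m : Fin 3 →₀ ℕ} (hm : m ∈ p.support) (hmM : (m 0 : ℝ) + K * m 1 + s * m 2 = M) :
    (limitPoly K s M p).coeff (m 2) ≠ 0 := by
  rw [limitPoly, Polynomial.finsetSum_coeff,
    Finset.sum_eq_single_of_mem m (Finset.mem_filter.2 ⟨hm, hmM⟩)]
  · rw [Polynomial.coeff_monomial_same]
    exact mul_ne_zero (mem_support_iff.1 hm)
      (pow_ne_zero _ (Complex.slitPlane_ne_zero two_pi_I_mem_slitPlane))
  · intro b hb hbm
    rw [Finset.mem_filter] at hb
    apply Polynomial.coeff_monomial_of_ne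
    intro h2
    apply hbm
    have hb0 : b 0 < K := (monomial_le_degreeOf 0 hb.1).trans_lt hK
    have hm0 : m 0 < K := (monomial_le_degreeOf 0 hm).trans_lt hK
    have heq : b 0 + K * b 1 = m 0 + K * m 1 := by
      have h := hb.2.trans hmM.symm
      rw [h2] at h
      have h' : (b 0 : ℝ) + K * b 1 = m 0 + K * m 1 := by linarith
      exact_mod_cast h'
    have e0 : b 0 = m 0 := by
      simpa [Nat.add_mul_mod_self_left, Nat.mod_eq_of_lt hb0, Nat.mod_eq_of_lt hm0] using
        congrArg (· % K) heq
    have e1 : b 1 = m 1 := by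
      rw [e0] at heq
      exact Nat.eq_of_mul_eq_mul_left (by omega) (Nat.add_left_cancel heq)
    ext i
    fin_cases i
    exacts [e0, e1, h2.symm]

theorem differentiableAt_normalized (M : ℝ) (p : MvPolynomial (Fin 3) ℂ) {n : ℕ} {u : ℂ}
    (h : Y K s (n, u) ∈ Complex.slitPlane) :
    DifferentiableAt ℂ (fun u ↦ normalized K s M p (n, u)) u := by
  have hY : DifferentiableAt ℂ (fun u ↦ Y K s (n, u)) u := by
    change DifferentiableAt ℂ (fun u : ℂ ↦
      2 * Real.pi * Complex.I + (s * Real.log n + u) / (n : ℂ) ^ K) u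
    exact ((differentiableAt_fun_id.const_add _).div_const _).const_add _
  have hx : DifferentiableAt ℂ (fun u ↦ x K s (n, u)) u := by
    change DifferentiableAt ℂ (fun u : ℂ ↦
      2 * Real.pi * Complex.I * n + K * Real.log n + Complex.log (Y K s (n, u))) u
    exact (hY.clog h).const_add _
  refine DifferentiableAt.fun_sum fun m _ ↦ ?_
  change DifferentiableAt ℂ (fun u : ℂ ↦ coeff m p *
    (Complex.exp (((m 0 + K * m 1 + s * m 2 - M) * Real.log n : ℝ)) *
      ((x K s (n, u) / n) ^ m 0 * Y K s (n, u) ^ m 1 * Complex.exp u ^ m 2))) u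
  refine DifferentiableAt.const_mul (DifferentiableAt.const_mul ?_ _) _
  fun_prop

end ExpExpZero

open ExpExpZero in
/-- If `p(x, y, z)` has a monomial free of `z` and one involving `z`, then `p(a, e^a, e^{e^a}) = 0`
for some `a` such that `a` and `e^a` are linearly independent over `ℚ`. -/
theorem exists_zero_exp_exp_linearIndependent {p : MvPolynomial (Fin 3) ℂ}
    (h0 : ∃ m ∈ p.support, m 2 = 0) (h1 : ∃ m ∈ p.support, m 2 ≠ 0) :
    ∃ a : ℂ, eval ![a, Complex.exp a, Complex.exp (Complex.exp a)] p = 0 ∧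
      LinearIndependent ℚ ![a, Complex.exp a] := by
  let K : ℕ := degreeOf 0 p + 2
  have hK0 : K ≠ 0 := by omega
  obtain ⟨s, M, hM, ⟨m₀, hm₀, hm₀z, hm₀M⟩, ⟨m₁, hm₁, hm₁z, hm₁M⟩⟩ :=
    exists_weight_max p.support K h0 h1
  have hQ0 := coeff_limitPoly_ne_zero (K := K) (by omega) hm₀ hm₀M
  rw [hm₀z] at hQ0
  obtain ⟨c, r, hr, hc, hsph⟩ := Polynomial.exists_isolated_zero_eval_exp hQ0 hm₁z
    (coeff_limitPoly_ne_zero (K := K) (by omega) hm₁ hm₁M)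
  have hslit : ∀ᶠ n in atTop, ∀ u ∈ closedBall c r, Y K s (n, u) ∈ Complex.slitPlane :=
    (isCompact_closedBall c r).eventually_forall_of_forall_eventually_prod fun u _ ↦
      (tendsto_Y hK0 u).eventually
        (Complex.isOpen_slitPlane.mem_nhds two_pi_I_mem_slitPlane)
  have hlin : ∀ᶠ n in atTop, ∀ u ∈ closedBall c r,
      LinearIndependent ℚ ![x K s (n, u), ((n : ℕ) : ℂ) ^ K * Y K s (n, u)] :=
    (isCompact_closedBall c r).eventually_forall_of_forall_eventually_prod fun u _ ↦
      eventually_linearIndependent (by omega) u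
  have hzero : ∀ᶠ n in atTop, ∃ u ∈ closedBall c r, normalized K s M p (n, u) = 0 := by
    refine eventually_exists_zero_of_tendsto
      (f := fun n u ↦ normalized K s M p (n, u)) hr
      ((limitPoly K s M p).continuous.comp Complex.continuous_exp) hc hsph ?_
      fun u _ ↦ tendsto_normalized hK0 hM u
    filter_upwards [hslit] with n hn
    refine DifferentiableOn.diffContOnCl fun u hu ↦ ?_
    rw [closure_ball c hr.ne'] at hu
    exact (differentiableAt_normalized M p (hn u hu)).differentiableWithinAt
  obtain ⟨n, hs, hl, ⟨u, hu, hzero⟩, hn⟩ :=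
    (hslit.and (hlin.and (hzero.and (eventually_ne_atTop 0)))).exists
  have hY := Complex.slitPlane_ne_zero (hs u hu)
  refine ⟨x K s (n, u), ?_, ?_⟩
  · rw [eval_eq_normalized M p hn hY, hzero, mul_zero]
  · rw [exp_x hn hY]
    exact hl u hu

end

/-- (SC) For a nonzero irreducible `p ∈ ℚ^alg[x,y,z]` depending on `x` and
`z`, there is `a ∈ ℂ` with `p(a, e^a, e^{e^a}) = 0` which is generic:
`td_ℚ(a, e^a, e^{e^a}) = 2`. -/
theorem generic_solution_z_expz_expexpz
    (hSC : SchanuelConjecture) (p : MvPolynomial (Fin 3) ℂ)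
    (hcoeff : ∀ mo : Fin 3 →₀ ℕ, IsAlgebraic ℚ (MvPolynomial.coeff mo p))
    (hp0 : p ≠ 0) (hirr : Irreducible p)
    (hx : MvPolynomial.degreeOf 0 p ≠ 0) (hz : MvPolynomial.degreeOf 2 p ≠ 0) :
    ∃ a : ℂ,
      MvPolynomial.eval ![a, Complex.exp a, Complex.exp (Complex.exp a)] p = 0 ∧
      HasTrdeg ({a, Complex.exp a, Complex.exp (Complex.exp a)} : Set ℂ) 2 := by
  have h0 : ∃ m ∈ p.support, m 2 = 0 :=
    MvPolynomial.exists_mem_support_apply_eq_zero hirr (by decide) hx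
  have h1 : ∃ m ∈ p.support, m 2 ≠ 0 := by
    by_contra! hcon
    exact hz (Nat.le_zero.1 (degreeOf_le_iff.2 fun m hm ↦ (hcon m hm).le))
  obtain ⟨a, ha, hind⟩ := exists_zero_exp_exp_linearIndependent h0 h1
  refine ⟨a, ha, ?_, fun e g hg hgind ↦ le_two_of_algebraicIndependent hcoeff hp0 ha ?_ hgind⟩
  · obtain ⟨f, hf, hfind⟩ := hSC 2 _ hind
    refine ⟨f, fun i ↦ ?_, hfind⟩
    rcases hf i with ⟨j, hj⟩ | ⟨j, hj⟩ <;> fin_cases j <;> simp_all [← hj]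
  · intro i
    rcases hg i with h | h | h
    exacts [⟨0, h.symm⟩, ⟨1, h.symm⟩, ⟨2, h.symm⟩]
end

section
/- Assume Schanuel's Conjecture. Let p(x,y,z,w) ∈ ℚ^alg[x,y,z,w] be a nonzero irreducible polynomial depending on x and on the last variable w. Then there exists a ∈ ℂ such that p(a, e^a, e^{e^a}, e^{e^{e^a}}) = 0 and td_ℚ(a, e^a, e^{e^a}, e^{e^{e^a}}) = 3. -/
open MvPolynomial

theorem AlgebraicIndependent.le_of_isAlgebraic_adjoin {T : Set ℂ} {n e : ℕ} (hT : T.encard ≤ n)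
    {g : Fin e → ℂ} (hg : AlgebraicIndependent ℚ g)
    (hgT : ∀ i, IsAlgebraic (IntermediateField.adjoin ℚ T) (g i)) : e ≤ n := by
  have h1 : (AlgebraicIndependent.matroid ℚ ℂ).Indep (Set.range g) := by
    rw [AlgebraicIndependent.matroid_indep_iff]
    exact hg.coe_range
  have h2 : Set.range g ⊆ (AlgebraicIndependent.matroid ℚ ℂ).closure T := by
    rintro _ ⟨i, rfl⟩
    rw [AlgebraicIndependent.matroid_closure_eq]
    have := hgT i
    rw [IntermediateField.isAlgebraic_adjoin_iff] at this
    simpa [Subalgebra.mem_algebraicClosure] using this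
  have h3 := (AlgebraicIndependent.matroid ℚ ℂ).eRk_closure_eq T
  have h4 := h1.encard_le_eRk_of_subset h2
  have h5 := (AlgebraicIndependent.matroid ℚ ℂ).eRk_le_encard T
  have h6 : (Set.range g).encard = e := by
    rw [← Set.image_univ, hg.injective.encard_image]
    simp
  rw [h3, h6] at h4
  exact_mod_cast h4.trans (h5.trans hT)

theorem exists_map_of_isAlgebraic {K : IntermediateField ℚ ℂ} (q : MvPolynomial (Fin 3) ℂ)
   (hq : ∀ m, IsAlgebraic ℚ (coeff m q)) :
   ∃ q' : MvPolynomial (Fin 3) (algebraicClosure K ℂ), q'.map (algebraMap _ ℂ) = q := by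
  have := (MvPolynomial.mem_range_map_iff_coeffs_subset
    (f := algebraMap (algebraicClosure K ℂ) ℂ) (x := q)).2
  apply this
  intro x hx
  obtain ⟨m, -, rfl⟩ := by simpa [MvPolynomial.mem_coeffs_iff] using hx
  have h : IsAlgebraic K (coeff m q) := (hq m).tower_top K
  exact ⟨⟨_, mem_algebraicClosure_iff.2 h⟩, rfl⟩

theorem Polynomial.eq_zero_of_sum_mul_X_pow {F : Type*} [Field F] {D M : ℕ}
   {B : ℕ → Polynomial F} (hB : ∀ h ≤ D, (B h).natDegree < M)
   (hsum : ∑ h ∈ Finset.range (D + 1), B h * Polynomial.X ^ (M * h) = 0) : B D = 0 := by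
  rw [Finset.sum_range_succ] at hsum
  by_contra hD
  have h1 : (∑ h ∈ Finset.range D, B h * Polynomial.X ^ (M * h)).degree < ((M * D : ℕ) : WithBot ℕ) := by
    rw [← Polynomial.mem_degreeLT]
    refine Submodule.sum_mem _ fun h hh => ?_
    have hh' := Finset.mem_range.1 hh
    rw [Polynomial.mem_degreeLT]
    refine (Polynomial.degree_mul_le _ _).trans_lt ?_
    rw [Polynomial.degree_X_pow]
    refine (add_le_add_left Polynomial.degree_le_natDegree _).trans_lt ?_
    have := hB h hh'.le
    have : (B h).natDegree + M * h < M * D := by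
      calc _ < M + M * h := by omega
        _ = M * (h + 1) := by ring
        _ ≤ M * D := Nat.mul_le_mul_left _ hh'
    exact_mod_cast this
  have h2 : (B D * Polynomial.X ^ (M * D)).degree ≥ ((M * D : ℕ) : WithBot ℕ) := by
    rw [Polynomial.degree_mul, Polynomial.degree_X_pow]
    have := Polynomial.zero_le_degree_iff.2 hD
    exact le_add_of_nonneg_left this
  rw [eq_neg_of_add_eq_zero_left hsum, Polynomial.degree_neg] at h1
  exact absurd h1 (not_lt.2 h2)


theorem natAbs_le_of_eval_eq_zero {F : Type*} [Field F] [Algebra F ℂ]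
    {P : Polynomial (MvPolynomial (Fin 3) ℂ)} {Q : ℕ → MvPolynomial (Fin 3) F}
    (hQ : ∀ i, (Q i).map (algebraMap F ℂ) = P.coeff i) {E : ℕ}
    (hE : ∀ i, (P.coeff i).totalDegree ≤ E) {Y : ℂ} (hY : Transcendental F Y) {l : F}
    (hl : l ≠ 0) {k : ℕ} {M N : ℤ} {v : Fin 3 → ℂ}
    (hv0 : v 0 = (M : ℂ)⁻¹ * (k * algebraMap F ℂ l ^ k - N * Y ^ k)) (hv1 : v 1 = Y ^ k)
    (hv2 : v 2 = algebraMap F ℂ l ^ k)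
    (hP : (P.map (eval v)).eval (Y ^ M * algebraMap F ℂ l ^ N) = 0)
    (h0 : eval v (P.coeff 0) ≠ 0) (hD : eval v P.leadingCoeff ≠ 0) : M.natAbs ≤ E * k := by
  by_contra! hM
  have hY0 : Y ≠ 0 := fun h => hY (h ▸ isAlgebraic_zero)
  set L := algebraMap F ℂ l with hL
  have hL0 : L ≠ 0 := by simpa [hL] using hl
  let V : Fin 3 → Polynomial F := ![Polynomial.C ((M : F)⁻¹) *
    (Polynomial.C (k * l ^ k) - Polynomial.C (N : F) * Polynomial.X ^ k), Polynomial.X ^ k,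
    Polynomial.C (l ^ k)]
  have hVY : ∀ i, Polynomial.aeval Y (V i) = v i := by
    intro i
    fin_cases i
    · simp [V, hv0, hL]
    · simp [V, hv1]
    · simp [V, hv2, hL]
  have hVdeg : ∀ i, (V i).natDegree ≤ k := by
    intro i
    fin_cases i
    · refine (Polynomial.natDegree_C_mul_le _ _).trans ?_
      refine (Polynomial.natDegree_sub_le _ _).trans ?_
      simp only [Polynomial.natDegree_C, Nat.zero_max]
      exact (Polynomial.natDegree_C_mul_le _ _).trans (by simp)
    · simp [V]
    · simp [V]
  let A : ℕ → Polynomial F := fun h => aeval V (Q h) * Polynomial.C ((l ^ N) ^ h)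
  have hAY : ∀ h, Polynomial.aeval Y (A h) = eval v (P.coeff h) * (L ^ N) ^ h := by
    intro h
    have : Polynomial.aeval Y (aeval V (Q h)) = eval v (P.coeff h) := by
      rw [← hQ h, eval_map, MvPolynomial.eval₂_eq', MvPolynomial.aeval_def,
        MvPolynomial.eval₂_eq', map_sum]
      simp [hVY]
    simp [A, this, hL]
  have hAdeg : ∀ h, (A h).natDegree < M.natAbs := by
    intro h
    refine lt_of_le_of_lt ?_ hM
    refine (Polynomial.natDegree_mul_C_le _ _).trans ?_
    refine MvPolynomial.aeval_natDegree_le _ ?_ _ hVdeg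
    refine le_trans (le_of_eq ?_) (hE h)
    rw [← hQ h, totalDegree, totalDegree,
      support_map_of_injective _ (algebraMap F ℂ).injective]
  have hne : ∀ h, eval v (P.coeff h) ≠ 0 → A h ≠ 0 := by
    intro h hh hA
    have := hAY h
    rw [hA, map_zero] at this
    exact mul_ne_zero hh (pow_ne_zero _ (zpow_ne_zero _ hL0)) this.symm
  have hsum : ∑ h ∈ Finset.range (P.natDegree + 1),
      eval v (P.coeff h) * (Y ^ M * L ^ N) ^ h = 0 := by
    rw [← hP, Polynomial.eval_map, Polynomial.eval₂_eq_sum_range]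
  have key : ∀ B : ℕ → Polynomial F, (∀ h, (B h).natDegree < M.natAbs) →
      ∑ h ∈ Finset.range (P.natDegree + 1), Polynomial.aeval Y (B h) * Y ^ (M.natAbs * h) = 0 →
      B P.natDegree = 0 := by
    intro B hB hs
    refine Polynomial.eq_zero_of_sum_mul_X_pow (fun h _ => hB h) ?_
    refine (transcendental_iff.1 hY) _ ?_
    simpa [map_sum] using hs
  rcases Int.natAbs_eq M with hm | hm
  · refine hne _ hD (key A hAdeg ?_)
    rw [← hsum]
    refine Finset.sum_congr rfl fun h _ => ?_
    rw [hAY, mul_pow]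
    nth_rw 2 [hm]
    rw [zpow_natCast, pow_mul]
    ring
  · refine hne 0 h0 ?_
    have := key (fun h => A (P.natDegree - h)) (fun h => hAdeg _) ?_
    · simpa using this
    rw [← Finset.sum_range_reflect]
    rw [← mul_zero (Y ^ (M.natAbs * P.natDegree)), ← hsum, Finset.mul_sum]
    refine Finset.sum_congr rfl fun h hh => ?_
    have hh' : h ≤ P.natDegree := by have := Finset.mem_range.1 hh; omega
    obtain ⟨j, hj⟩ := Nat.exists_eq_add_of_le hh'
    rw [show P.natDegree - (P.natDegree + 1 - 1 - h) = h by omega,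
      show P.natDegree + 1 - 1 - h = j by omega, hAY, mul_pow, hj]
    nth_rw 3 [hm]
    rw [zpow_neg, zpow_natCast, inv_pow, mul_add, pow_add, pow_mul]
    field_simp
    rw [pow_mul]

theorem transcendental_exp_div (hSC : SchanuelConjecture) {a b c : ℂ} (hb : b = Complex.exp a)
    (hc : c = Complex.exp b) (hab : LinearIndependent ℚ ![a, b]) {k : ℕ} (hk : k ≠ 0)
    {M N : ℤ} (hM : M ≠ 0) (hrel : k * c = M * a + N * b) :
    Transcendental (IntermediateField.adjoin ℚ {Complex.exp (b / k)}) (Complex.exp (a / k)) := by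
  have hk' : (k : ℂ) ≠ 0 := by exact_mod_cast hk
  have hM' : (M : ℂ) ≠ 0 := by exact_mod_cast hM
  set L := Complex.exp (b / k) with hL
  intro hY
  set K := algebraicClosure (IntermediateField.adjoin ℚ {L}) ℂ with hK
  have hLK : L ∈ K := mem_algebraicClosure_iff.2 (isAlgebraic_algebraMap
    (⟨L, IntermediateField.mem_adjoin_simple_self ℚ L⟩ : IntermediateField.adjoin ℚ {L}))
  have hbK : b ∈ K := by
    have : b = Complex.exp (a / k) ^ k := by
      rw [← Complex.exp_nat_mul, mul_div_cancel₀ _ hk', hb]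
    rw [this]
    exact pow_mem (mem_algebraicClosure_iff.2 hY) _
  have hcK : c ∈ K := by
    have : c = L ^ k := by
      rw [hL, ← Complex.exp_nat_mul, mul_div_cancel₀ _ hk', hc]
    rw [this]
    exact pow_mem hLK _
  have haK : a ∈ K := by
    have : a = (M : ℂ)⁻¹ * (k * c - N * b) := by
      rw [hrel]
      field_simp
      ring
    rw [this]
    exact mul_mem (inv_mem (intCast_mem _ _)) (sub_mem (mul_mem (natCast_mem _ _) hcK)
      (mul_mem (intCast_mem _ _) hbK))
  obtain ⟨f, hf, hfi⟩ := hSC 2 _ hab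
  have : 2 ≤ 1 := hfi.le_of_isAlgebraic_adjoin (T := {L}) (by simp) fun i => by
    refine mem_algebraicClosure_iff.1 (?_ : f i ∈ K)
    rcases hf i with ⟨j, hj⟩ | ⟨j, hj⟩ <;> rw [← hj] <;> fin_cases j
    · exact haK
    · exact hbK
    · simpa [← hb] using hbK
    · simpa [← hc] using hcK
  omega

theorem linearIndependent_of_real_bound (hSC : SchanuelConjecture)
    {P : Polynomial (MvPolynomial (Fin 3) ℂ)}
    (hcoeff : ∀ i m, IsAlgebraic ℚ (coeff m (P.coeff i))) {E : ℕ}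
    (hE : ∀ i, (P.coeff i).totalDegree ≤ E) {a b c : ℂ} (hb : b = Complex.exp a)
    (hc : c = Complex.exp b) (hP : (P.map (eval ![a, b, c])).eval (Complex.exp c) = 0)
    (h0 : eval ![a, b, c] (P.coeff 0) ≠ 0) (hD : eval ![a, b, c] P.leadingCoeff ≠ 0)
    (hab : ∀ r s : ℝ, (r : ℂ) * a + s * b = 0 → r = 0 ∧ s = 0)
    (habc : ∀ r s : ℝ, c = r * a + s * b → (E : ℝ) < |r|) :
    LinearIndependent ℚ ![a, b, c] := by
  have hab' : LinearIndependent ℚ ![a, b] := by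
    rw [LinearIndependent.pair_iff]
    intro r s h
    have := hab r s (by simpa [Algebra.smul_def] using h)
    exact_mod_cast this
  have : (![a, b, c] : Fin 3 → ℂ) = Fin.snoc ![a, b] c := by
    ext i; fin_cases i <;> rfl
  rw [this, linearIndependent_finSnoc]
  refine ⟨hab', fun hmem => ?_⟩
  have hr : Set.range ![a, b] = {a, b} := by simp [Set.pair_comm]
  rw [hr, Submodule.mem_span_pair] at hmem
  obtain ⟨r, s, hrs⟩ := hmem
  have hrE : (E : ℝ) < |(r : ℝ)| := habc r s (by rw [← hrs]; simp [Algebra.smul_def])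
  have hr0 : r ≠ 0 := by
    rintro rfl
    have : (0 : ℝ) ≤ E := by positivity
    simp at hrE
    linarith
  set k := r.den * s.den with hk
  have hk0 : k ≠ 0 := mul_ne_zero r.den_ne_zero s.den_ne_zero
  have hk' : (k : ℂ) ≠ 0 := by exact_mod_cast hk0
  set M : ℤ := r.num * s.den with hM
  set N : ℤ := s.num * r.den with hN
  have hM0 : M ≠ 0 := mul_ne_zero (Rat.num_ne_zero.2 hr0) (by exact_mod_cast s.den_ne_zero)
  have hMq : (M : ℚ) = k * r := by
    rw [hM, hk]
    push_cast
    rw [mul_right_comm, Rat.den_mul_eq_num]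
  have hNq : (N : ℚ) = k * s := by
    rw [hN, hk]
    push_cast
    rw [mul_assoc, Rat.den_mul_eq_num, mul_comm]
  have hMc : (M : ℂ) = k * r := by exact_mod_cast congrArg (Rat.cast : ℚ → ℂ) hMq
  have hNc : (N : ℂ) = k * s := by exact_mod_cast congrArg (Rat.cast : ℚ → ℂ) hNq
  have hrel : k * c = M * a + N * b := by
    rw [← hrs, hMc, hNc]
    simp only [Algebra.smul_def, eq_ratCast]
    ring
  have hY := transcendental_exp_div hSC hb hc hab' hk0 hM0 hrel
  set L := Complex.exp (b / k) with hL
  let F := algebraicClosure (IntermediateField.adjoin ℚ {L}) ℂ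
  have hLF : L ∈ F := mem_algebraicClosure_iff.2 (isAlgebraic_algebraMap
    (⟨L, IntermediateField.mem_adjoin_simple_self ℚ L⟩ : IntermediateField.adjoin ℚ {L}))
  choose Q hQ using fun i => exists_map_of_isAlgebraic
    (K := IntermediateField.adjoin ℚ {L}) (P.coeff i) (hcoeff i)
  have hLc : L ^ k = c := by rw [hL, ← Complex.exp_nat_mul, mul_div_cancel₀ _ hk', hc]
  have hYb : Complex.exp (a / k) ^ k = b := by
    rw [← Complex.exp_nat_mul, mul_div_cancel₀ _ hk', hb]
  have := natAbs_le_of_eval_eq_zero (F := F) hQ hE (Y := Complex.exp (a / k))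
    (fun h => hY (h.restrictScalars _)) (l := ⟨L, hLF⟩)
    (fun h => Complex.exp_ne_zero (b / k) (congrArg Subtype.val h)) (k := k) (M := M) (N := N)
    (v := ![a, b, c]) ?_ ?_ ?_ ?_ h0 hD
  · have h1 : (M.natAbs : ℝ) = k * |(r : ℝ)| := by
      rw [Nat.cast_natAbs, Int.cast_abs]
      have : (M : ℝ) = k * r := by exact_mod_cast congrArg (Rat.cast : ℚ → ℝ) hMq
      rw [this, abs_mul, Nat.abs_cast]
    have h2 : (M.natAbs : ℝ) ≤ E * k := by exact_mod_cast this
    have h3 : (0 : ℝ) < k := by exact_mod_cast Nat.pos_of_ne_zero hk0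
    rw [h1, mul_comm] at h2
    exact absurd (le_of_mul_le_mul_right h2 h3) (not_le.2 hrE)
  · change a = (M : ℂ)⁻¹ * (k * L ^ k - N * Complex.exp (a / k) ^ k)
    rw [hLc, hYb, hrel]
    have hM' : (M : ℂ) ≠ 0 := by exact_mod_cast hM0
    field_simp
    ring
  · exact hYb.symm
  · exact hLc.symm
  · change Polynomial.eval (Complex.exp (a / k) ^ M * L ^ N) _ = 0
    rw [hL, ← Complex.exp_int_mul, ← Complex.exp_int_mul, ← Complex.exp_add]
    rw [show (M : ℂ) * (a / k) + N * (b / k) = c by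
      rw [mul_div_assoc', mul_div_assoc', ← add_div, ← hrel, mul_div_cancel_left₀ _ hk']]
    exact hP

theorem hasTrdeg_of_linearIndependent (hSC : SchanuelConjecture)
    {P : Polynomial (MvPolynomial (Fin 3) ℂ)}
    (hcoeff : ∀ i m, IsAlgebraic ℚ (coeff m (P.coeff i))) {a b c d : ℂ} (hb : b = Complex.exp a)
    (hc : c = Complex.exp b) (hd : d = Complex.exp c) (hP : (P.map (eval ![a, b, c])).eval d = 0)
    (hD : eval ![a, b, c] P.leadingCoeff ≠ 0) (h : LinearIndependent ℚ ![a, b, c]) :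
    HasTrdeg ({a, b, c, d} : Set ℂ) 3 := by
  refine ⟨?_, fun e g hg hgi => ?_⟩
  · obtain ⟨f, hf, hfi⟩ := hSC 3 _ h
    refine ⟨f, fun i => ?_, hfi⟩
    rcases hf i with ⟨j, hj⟩ | ⟨j, hj⟩ <;> rw [← hj] <;> fin_cases j <;> simp [← hb, ← hc, ← hd]
  · set T : Set ℂ := {a, b, c}
    let K := algebraicClosure (IntermediateField.adjoin ℚ T) ℂ
    have hTK : ∀ x ∈ T, x ∈ K := fun x hx => mem_algebraicClosure_iff.2 (isAlgebraic_algebraMap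
      (⟨x, IntermediateField.subset_adjoin ℚ T hx⟩ : IntermediateField.adjoin ℚ T))
    have hdK : IsAlgebraic (IntermediateField.adjoin ℚ T) d := by
      choose Q hQ using fun i => exists_map_of_isAlgebraic
        (K := IntermediateField.adjoin ℚ T) (P.coeff i) (hcoeff i)
      let V : Fin 3 → K := ![⟨a, hTK a (by simp [T])⟩, ⟨b, hTK b (by simp [T])⟩,
        ⟨c, hTK c (by simp [T])⟩]
      have hV : ∀ i, algebraMap K ℂ (V i) = ![a, b, c] i := by
        intro i; fin_cases i <;> rfl
      have hQV : ∀ i, algebraMap K ℂ (eval V (Q i)) = eval ![a, b, c] (P.coeff i) := by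
        intro i
        rw [← hQ i, eval_map, eval₂_eq', MvPolynomial.eval_eq', map_sum]
        simp only [map_mul, map_prod, map_pow, hV]
        rfl
      have hdK' : IsAlgebraic K d := by
        refine ⟨∑ i ∈ Finset.range (P.natDegree + 1),
          Polynomial.C (eval V (Q i)) * Polynomial.X ^ i, fun h0 => hD ?_, ?_⟩
        · have := congrArg (Polynomial.coeff · P.natDegree) h0
          simp only [Polynomial.finsetSum_coeff, Polynomial.coeff_C_mul_X_pow] at this
          rw [Finset.sum_ite_eq] at this
          simp only [Finset.mem_range, Nat.lt_succ_self, if_true, Polynomial.coeff_zero] at this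
          rw [Polynomial.leadingCoeff, ← hQV, this, map_zero]
        · rw [map_sum]
          simp only [map_mul, Polynomial.aeval_C, hQV, map_pow, Polynomial.aeval_X]
          rw [← hP, Polynomial.eval_map, Polynomial.eval₂_eq_sum_range]
      exact hdK'.restrictScalars _
    refine hgi.le_of_isAlgebraic_adjoin (T := T) ?_ fun i => ?_
    · have h1 := Set.encard_insert_le ({b, c} : Set ℂ) a
      have h2 := (Set.encard_insert_le {c} b).trans_eq (by rw [Set.encard_singleton])
      exact h1.trans ((add_le_add_left h2 1).trans (by norm_num))
    · have := hg i
      simp only [Set.mem_insert_iff, Set.mem_singleton_iff] at this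
      rcases this with h | h | h | h
      · exact mem_algebraicClosure_iff.1 (hTK _ (by simp [T, h]))
      · exact mem_algebraicClosure_iff.1 (hTK _ (by simp [T, h]))
      · exact mem_algebraicClosure_iff.1 (hTK _ (by simp [T, h]))
      · rw [h]; exact hdK

open Filter Topology Bornology in
theorem tendsto_log_cobounded : Tendsto Complex.log (cobounded ℂ) (cobounded ℂ) := by
  rw [← tendsto_norm_atTop_iff_cobounded]
  have h1 : Tendsto (fun c : ℂ => Real.log ‖c‖) (cobounded ℂ) atTop :=
    Real.tendsto_log_atTop.comp tendsto_norm_cobounded_atTop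
  refine tendsto_atTop_mono (fun c => ?_) h1
  rw [← Complex.log_re]
  exact (le_abs_self _).trans (Complex.abs_re_le_norm _)

open Filter Topology Bornology in
theorem tendsto_norm_log_pow_div (n : ℕ) :
    Tendsto (fun c : ℂ => ‖Complex.log c‖ ^ n / ‖c‖) (cobounded ℂ) (𝓝 0) := by
  have h1 : Tendsto (fun x : ℝ => 2 ^ n * (Real.log x ^ n / x)) atTop (𝓝 0) := by
    simpa using (Real.isLittleO_pow_log_id_atTop (n := n)).tendsto_div_nhds_zero.const_mul (2 ^ n)
  have h2 : Tendsto (fun c : ℂ => ‖c‖) (cobounded ℂ) atTop := tendsto_norm_cobounded_atTop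
  have h3 : ∀ᶠ c : ℂ in cobounded ℂ, Real.pi ≤ Real.log ‖c‖ :=
    (Real.tendsto_log_atTop.comp h2).eventually_ge_atTop _
  refine squeeze_zero' (Eventually.of_forall fun c => by positivity) ?_ (h1.comp h2)
  filter_upwards [h3] with c hc
  have h4 : ‖Complex.log c‖ ≤ 2 * Real.log ‖c‖ := by
    refine (Complex.norm_le_abs_re_add_abs_im _).trans ?_
    rw [Complex.log_re, Complex.log_im, abs_of_nonneg (Real.pi_pos.le.trans hc)]
    linarith [Complex.abs_arg_le_pi c]
  calc ‖Complex.log c‖ ^ n / ‖c‖ ≤ (2 * Real.log ‖c‖) ^ n / ‖c‖ := by gcongr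
    _ = _ := by simp only [Function.comp]; ring

/-- The vector `(log log c, log c, c)`. -/
noncomputable def logVec (c : ℂ) : Fin 3 → ℂ := ![Complex.log (Complex.log c), Complex.log c, c]

/-- The monomial with exponent `m` in `log log c`, `log c` and `c`. -/
noncomputable def logMonomial (m : Fin 3 →₀ ℕ) (c : ℂ) : ℂ := ∏ i, logVec c i ^ m i

theorem logMonomial_eq (m : Fin 3 →₀ ℕ) (c : ℂ) :
    logMonomial m c = Complex.log (Complex.log c) ^ m 0 * Complex.log c ^ m 1 * c ^ m 2 := by
  simp [logMonomial, Fin.prod_univ_three, logVec]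

open Filter Topology Bornology in
theorem eventually_logVec :
    ∀ᶠ c : ℂ in cobounded ℂ, 1 ≤ ‖Complex.log (Complex.log c)‖ ∧
      ‖Complex.log (Complex.log c)‖ ≤ ‖Complex.log c‖ ∧ ‖Complex.log c‖ ≤ ‖c‖ := by
  have h : ∀ᶠ c : ℂ in cobounded ℂ, ‖Complex.log c‖ ≤ ‖c‖ := by
    filter_upwards [(tendsto_norm_log_pow_div 1).eventually_le_const one_pos,
      tendsto_norm_cobounded_atTop.eventually_gt_atTop 0] with c hc hc'
    rwa [pow_one, div_le_one hc'] at hc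
  have h1 : ∀ᶠ c : ℂ in cobounded ℂ, 1 ≤ ‖c‖ :=
    tendsto_norm_cobounded_atTop.eventually_ge_atTop 1
  filter_upwards [h, tendsto_log_cobounded.eventually h,
    (tendsto_log_cobounded.comp tendsto_log_cobounded).eventually h1] with c h2 h3 h4
  exact ⟨h4, h3, h2⟩

theorem mul_pow_div_le {x y z : ℝ} (hx : 1 ≤ x) (hxy : x ≤ y) (hyz : y ≤ z) {i j k i' j' k' : ℕ}
    (hk : k' < k) : x ^ i' * y ^ j' * z ^ k' / (x ^ i * y ^ j * z ^ k) ≤ y ^ (i' + j') / z := by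
  have hy : 1 ≤ y := hx.trans hxy
  have hz : 1 ≤ z := hy.trans hyz
  rw [div_le_div_iff₀ (by positivity) (by positivity)]
  calc x ^ i' * y ^ j' * z ^ k' * z ≤ y ^ i' * y ^ j' * z ^ k' * z := by gcongr
    _ = y ^ (i' + j') * (1 * 1 * z ^ (k' + 1)) := by ring
    _ ≤ y ^ (i' + j') * (x ^ i * y ^ j * z ^ k) := by
      gcongr
      · exact one_le_pow₀ hx
      · exact one_le_pow₀ hy
      · omega

open Filter Topology Bornology in
theorem tendsto_logMonomial_div {m m' : Fin 3 →₀ ℕ}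
    (h : toLex (m' 2, toLex (m' 1, m' 0)) < toLex (m 2, toLex (m 1, m 0))) :
    Tendsto (fun c => logMonomial m' c / logMonomial m c) (cobounded ℂ) (𝓝 0) := by
  rw [tendsto_zero_iff_norm_tendsto_zero]
  simp only [logMonomial_eq, norm_div, norm_mul, norm_pow]
  rw [Prod.Lex.toLex_lt_toLex, Prod.Lex.toLex_lt_toLex] at h
  rcases h with h | ⟨h2, h | ⟨h1, h0⟩⟩
  · refine squeeze_zero' (Eventually.of_forall fun c => by positivity) ?_
      (tendsto_norm_log_pow_div (m' 0 + m' 1))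
    filter_upwards [eventually_logVec] with c hc
    exact mul_pow_div_le hc.1 hc.2.1 hc.2.2 h
  · refine squeeze_zero' (Eventually.of_forall fun c => by positivity) ?_
      ((tendsto_norm_log_pow_div (m' 0 + 0)).comp tendsto_log_cobounded)
    filter_upwards [eventually_logVec] with c hc
    simp only at h2 h
    have hz : 0 < ‖c‖ := by linarith
    rw [h2, mul_div_mul_right _ _ (by positivity)]
    simpa using mul_pow_div_le hc.1 le_rfl hc.2.1 (i := m 0) (j := 0) (i' := m' 0) (j' := 0) h
  · simp only at h2 h1 h0
    have h3 : Tendsto (fun c : ℂ => ‖Complex.log (Complex.log c)‖⁻¹) (cobounded ℂ) (𝓝 0) :=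
      tendsto_inv_atTop_zero.comp (tendsto_norm_cobounded_atTop.comp
        (tendsto_log_cobounded.comp tendsto_log_cobounded))
    refine squeeze_zero' (Eventually.of_forall fun c => by positivity) ?_ h3
    filter_upwards [eventually_logVec] with c hc
    have hy : 0 < ‖Complex.log c‖ := by linarith
    have hz : 0 < ‖c‖ := by linarith
    rw [h2, h1, mul_div_mul_right _ _ (by positivity), mul_div_mul_right _ _ (by positivity)]
    simpa using mul_pow_div_le le_rfl le_rfl hc.1 (i := 0) (j := 0) (i' := 0) (j' := 0) h0

open Filter Topology Bornology in
theorem exists_tendsto_eval_div_logMonomial {q : MvPolynomial (Fin 3) ℂ} (hq : q ≠ 0) :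
    ∃ (m : Fin 3 →₀ ℕ) (C : ℂ), C ≠ 0 ∧
      Tendsto (fun c => eval (logVec c) q / logMonomial m c) (cobounded ℂ) (𝓝 C) := by
  obtain ⟨m, hm, hmax⟩ := q.support.exists_max_image
    (fun m => toLex (m 2, toLex (m 1, m 0))) (support_nonempty.2 hq)
  refine ⟨m, coeff m q, mem_support_iff.1 hm, ?_⟩
  have h : ∀ m' ∈ q.support, Tendsto (fun c => coeff m' q * (logMonomial m' c / logMonomial m c))
      (cobounded ℂ) (𝓝 (if m' = m then coeff m q else 0)) := by
    intro m' hm'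
    split_ifs with hmm
    · subst hmm
      refine tendsto_const_nhds.congr' ?_
      filter_upwards [eventually_logVec] with c hc
      have h1 : Complex.log (Complex.log c) ≠ 0 := norm_pos_iff.1 (by linarith)
      have h2 : Complex.log c ≠ 0 := norm_pos_iff.1 (by linarith)
      have h3 : c ≠ 0 := norm_pos_iff.1 (by linarith)
      have : logMonomial m' c ≠ 0 := by
        rw [logMonomial_eq]
        positivity
      rw [div_self this, mul_one]
    · have hlt : toLex (m' 2, toLex (m' 1, m' 0)) < toLex (m 2, toLex (m 1, m 0)) := by
        refine lt_of_le_of_ne (hmax m' hm') fun he => hmm ?_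
        have he' := toLex.injective he
        simp only [Prod.mk.injEq, EmbeddingLike.apply_eq_iff_eq] at he'
        ext i
        fin_cases i
        · exact he'.2.2
        · exact he'.2.1
        · exact he'.1
      simpa using (tendsto_logMonomial_div hlt).const_mul (coeff m' q)
  have := tendsto_finsetSum q.support h
  rw [Finset.sum_ite_eq' q.support m, if_pos hm] at this
  refine this.congr fun c => ?_
  rw [MvPolynomial.eval_eq', Finset.sum_div]
  exact Finset.sum_congr rfl fun m' _ => by
    simp only [logMonomial, mul_div_assoc]

open Filter Topology Bornology in
theorem tendsto_cobounded_of_div {ι : Type*} {l : Filter ι} {f g : ι → ℂ}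
    (hf : Tendsto f l (cobounded ℂ)) (h : Tendsto (fun i => g i / f i) l (𝓝 1)) :
    Tendsto g l (cobounded ℂ) := by
  rw [← tendsto_norm_atTop_iff_cobounded] at hf ⊢
  have h1 : Tendsto (fun i => ‖g i / f i‖) l (𝓝 1) := by simpa using h.norm
  refine (hf.atTop_mul_pos one_pos h1).congr' ?_
  filter_upwards [hf.eventually_gt_atTop 0] with i hi
  rw [norm_div, mul_div_cancel₀ _ hi.ne']

open Filter Topology Bornology in
theorem tendsto_log_div_log {ι : Type*} {l : Filter ι} {f g : ι → ℂ}
    (hf : Tendsto f l (cobounded ℂ)) (h : Tendsto (fun i => g i / f i) l (𝓝 1)) :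
    Tendsto (fun i => Complex.log (g i) / Complex.log (f i)) l (𝓝 1) := by
  have hg := tendsto_cobounded_of_div hf h
  have hlf : Tendsto (fun i => ‖Complex.log (f i)‖) l atTop :=
    tendsto_norm_cobounded_atTop.comp (tendsto_log_cobounded.comp hf)
  have hlog : Tendsto (fun i => Real.log ‖g i / f i‖) l (𝓝 0) := by
    have h1 : Tendsto (fun i => ‖g i / f i‖) l (𝓝 1) := by simpa using h.norm
    simpa using h1.log one_ne_zero
  have hdiff : Tendsto (fun i => Complex.log (g i) / Complex.log (f i) - 1) l (𝓝 0) := by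
    rw [tendsto_zero_iff_norm_tendsto_zero]
    refine squeeze_zero' (Eventually.of_forall fun c => by positivity) ?_
      (hlf.const_div_atTop (1 + (Real.pi + Real.pi)))
    filter_upwards [hlf.eventually_gt_atTop 0, hlog.norm.eventually_lt_const (by simp : ‖(0 : ℝ)‖ < 1),
      (tendsto_norm_cobounded_atTop.comp hf).eventually_gt_atTop 0,
      (tendsto_norm_cobounded_atTop.comp hg).eventually_gt_atTop 0] with i hi hi1 hfi hgi
    simp only [Function.comp] at hfi hgi
    rw [div_sub_one (norm_pos_iff.1 hi), norm_div]
    gcongr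
    refine (Complex.norm_le_abs_re_add_abs_im _).trans ?_
    rw [Complex.sub_re, Complex.sub_im, Complex.log_re, Complex.log_re, Complex.log_im,
      Complex.log_im]
    rw [norm_div, Real.log_div hgi.ne' hfi.ne', Real.norm_eq_abs] at hi1
    refine add_le_add hi1.le ((abs_sub _ _).trans (add_le_add ?_ ?_)) <;>
      exact Complex.abs_arg_le_pi _
  simpa using hdiff.add_const 1

open Filter Topology Bornology in
theorem tendsto_eval_logVec_div {ι : Type*} {l : Filter ι} {f g : ι → ℂ}
    (hf : Tendsto f l (cobounded ℂ)) (h : Tendsto (fun i => g i / f i) l (𝓝 1))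
    {q : MvPolynomial (Fin 3) ℂ} (hq : q ≠ 0) :
    Tendsto (fun i => eval (logVec (g i)) q / eval (logVec (f i)) q) l (𝓝 1) := by
  obtain ⟨m, C, hC, hm⟩ := exists_tendsto_eval_div_logMonomial hq
  have hg := tendsto_cobounded_of_div hf h
  have h1 := tendsto_log_div_log hf h
  have h2 := tendsto_log_div_log (tendsto_log_cobounded.comp hf) h1
  have h3 : Tendsto (fun i => logMonomial m (g i) / logMonomial m (f i)) l (𝓝 1) := by
    have := ((h2.pow (m 0)).mul (h1.pow (m 1))).mul (h.pow (m 2))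
    simp only [one_pow, mul_one] at this
    refine this.congr fun i => ?_
    simp only [logMonomial_eq, Function.comp]
    ring
  have h4 := ((hm.comp hg).div (hm.comp hf) hC).mul h3
  rw [div_self hC, one_mul] at h4
  have hne : ∀ᶠ c : ℂ in cobounded ℂ, logMonomial m c ≠ 0 := by
    filter_upwards [eventually_logVec] with c hc
    have h1 : Complex.log (Complex.log c) ≠ 0 := norm_pos_iff.1 (by linarith)
    have h2 : Complex.log c ≠ 0 := norm_pos_iff.1 (by linarith)
    have h3 : c ≠ 0 := norm_pos_iff.1 (by linarith)
    rw [logMonomial_eq]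
    positivity
  refine h4.congr' ?_
  filter_upwards [hf.eventually hne, hg.eventually hne] with i hi hi'
  simp only [Pi.div_apply, Function.comp_apply]
  field_simp

open Filter Topology Bornology in
theorem exists_eventually_norm_eval_logVec {q : MvPolynomial (Fin 3) ℂ} (hq : q ≠ 0) :
    ∃ K : ℕ, ∀ᶠ c : ℂ in cobounded ℂ,
      ‖c‖⁻¹ ≤ ‖eval (logVec c) q‖ ∧ ‖eval (logVec c) q‖ ≤ ‖c‖ ^ K := by
  obtain ⟨m, C, hC, hm⟩ := exists_tendsto_eval_div_logMonomial hq
  have hC' : 0 < ‖C‖ := norm_pos_iff.2 hC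
  have hz : Tendsto (fun c : ℂ => ‖c‖) (cobounded ℂ) atTop := tendsto_norm_cobounded_atTop
  refine ⟨m 0 + m 1 + m 2 + 1, ?_⟩
  filter_upwards [eventually_logVec, hm.norm.eventually_const_lt (half_lt_self hC'),
    hm.norm.eventually_lt_const (lt_add_one ‖C‖), hz.eventually_ge_atTop (2 / ‖C‖),
    hz.eventually_ge_atTop (‖C‖ + 1)] with c hc h1 h2 h3 h4
  have hy1 : 1 ≤ ‖Complex.log c‖ := hc.1.trans hc.2.1
  have hz1 : 1 ≤ ‖c‖ := hy1.trans hc.2.2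
  have hM1 : 1 ≤ ‖logMonomial m c‖ := by
    rw [logMonomial_eq]
    simp only [norm_mul, norm_pow]
    exact one_le_mul_of_one_le_of_one_le (one_le_mul_of_one_le_of_one_le (one_le_pow₀ hc.1)
      (one_le_pow₀ hy1)) (one_le_pow₀ hz1)
  have hM2 : ‖logMonomial m c‖ ≤ ‖c‖ ^ (m 0 + m 1 + m 2) := by
    rw [logMonomial_eq, pow_add, pow_add]
    simp only [norm_mul, norm_pow]
    gcongr
    · exact hc.2.1.trans hc.2.2
    · exact hc.2.2
  rw [norm_div] at h1 h2
  rw [lt_div_iff₀ (by linarith)] at h1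
  rw [div_lt_iff₀ (by linarith)] at h2
  constructor
  · rw [inv_le_comm₀ (by linarith) (by nlinarith)]
    refine le_trans ?_ h3
    rw [← inv_div]
    gcongr
    nlinarith
  · calc ‖eval (logVec c) q‖ ≤ (‖C‖ + 1) * ‖logMonomial m c‖ := h2.le
      _ ≤ ‖c‖ * ‖c‖ ^ (m 0 + m 1 + m 2) := by gcongr
      _ = _ := by ring

open Filter Bornology in
theorem eventually_eval_logVec_ne_zero {q : MvPolynomial (Fin 3) ℂ} (hq : q ≠ 0) :
    ∀ᶠ c : ℂ in cobounded ℂ, eval (logVec c) q ≠ 0 := by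
  obtain ⟨_, hl⟩ := exists_eventually_norm_eval_logVec hq
  filter_upwards [hl, eventually_ne_cobounded 0] with c hc hc'
  have : 0 < ‖eval (logVec c) q‖ := lt_of_lt_of_le (by positivity) hc.1
  exact norm_pos_iff.1 this

theorem Polynomial.norm_le_of_isRoot {R : Polynomial ℂ} {B : ℝ} (hB : 1 ≤ B)
    (hc : ∀ i, ‖R.coeff i‖ ≤ B) (hl : B⁻¹ ≤ ‖R.leadingCoeff‖) {W : ℂ} (hW : R.IsRoot W) :
    ‖W‖ ≤ B ^ 2 + 1 := by
  have hB0 : 0 < B := by linarith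
  have hl0 : 0 < ‖R.leadingCoeff‖ := (inv_pos.2 hB0).trans_le hl
  have hR : R ≠ 0 := by
    rintro rfl
    simp at hl0
  have h1 : (‖W‖₊ : ℝ) < R.cauchyBound := NNReal.coe_lt_coe.2 (hW.norm_lt_cauchyBound hR)
  rw [Polynomial.cauchyBound, coe_nnnorm] at h1
  refine h1.le.trans ?_
  push_cast
  gcongr
  have h2 : ((Finset.range R.natDegree).sup fun i => ‖R.coeff i‖₊) ≤ B.toNNReal :=
    Finset.sup_le fun i _ => (Real.le_toNNReal_iff_coe_le hB0.le).2 (hc i)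
  have h3 : (((Finset.range R.natDegree).sup fun i => ‖R.coeff i‖₊ : NNReal) : ℝ) ≤ B :=
    (Real.le_toNNReal_iff_coe_le hB0.le).1 h2
  calc _ ≤ B / B⁻¹ := by gcongr
    _ = B ^ 2 := by rw [div_inv_eq_mul, sq]

theorem Polynomial.abs_log_norm_le_of_isRoot {R : Polynomial ℂ} {B : ℝ} (hB : 1 ≤ B)
    (hc : ∀ i, ‖R.coeff i‖ ≤ B) (hl : B⁻¹ ≤ ‖R.leadingCoeff‖) (h0 : B⁻¹ ≤ ‖R.coeff 0‖) {W : ℂ}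
    (hW : R.IsRoot W) : W ≠ 0 ∧ |Real.log ‖W‖| ≤ Real.log (B ^ 2 + 1) := by
  have hB0 : 0 < B := by linarith
  have hR0 : R.coeff 0 ≠ 0 := norm_pos_iff.1 ((inv_pos.2 hB0).trans_le h0)
  have hW0 : W ≠ 0 := by
    rintro rfl
    exact hR0 (by rw [Polynomial.coeff_zero_eq_eval_zero]; exact hW)
  refine ⟨hW0, abs_le'.2 ⟨?_, ?_⟩⟩
  · exact Real.log_le_log (norm_pos_iff.2 hW0) (norm_le_of_isRoot hB hc hl hW)
  · rw [← Real.log_inv, ← norm_inv]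
    refine Real.log_le_log (norm_pos_iff.2 (inv_ne_zero hW0)) ?_
    refine norm_le_of_isRoot (R := R.reverse) hB (fun i => ?_) ?_ ?_
    · rw [Polynomial.coeff_reverse]
      exact hc _
    · rwa [Polynomial.reverse_leadingCoeff, Polynomial.trailingCoeff,
        Polynomial.natTrailingDegree_eq_zero.2 (Or.inr hR0)]
    · let := invertibleOfNonzero hW0
      have := (Polynomial.eval₂_reverse_eq_zero_iff (RingHom.id ℂ) W R).2 hW
      rwa [invOf_eq_inv] at this

open Filter Topology Bornology in
theorem exists_eventually_norm_log_root_le {P : Polynomial (MvPolynomial (Fin 3) ℂ)}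
    (h0 : P.coeff 0 ≠ 0) : ∃ K : ℝ, ∀ᶠ c : ℂ in cobounded ℂ,
      ∀ W, (P.map (eval (logVec c))).IsRoot W → W ≠ 0 ∧ ‖Complex.log W‖ ≤ K * Real.log ‖c‖ := by
  have hP : P ≠ 0 := by
    rintro rfl
    simp at h0
  have hbound : ∀ i, ∃ K : ℕ, ∀ᶠ c : ℂ in cobounded ℂ,
      ‖eval (logVec c) (P.coeff i)‖ ≤ ‖c‖ ^ K := by
    intro i
    by_cases hi : P.coeff i = 0
    · exact ⟨0, Eventually.of_forall fun c => by simp [hi]⟩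
    · obtain ⟨K, hK⟩ := exists_eventually_norm_eval_logVec hi
      exact ⟨K, hK.mono fun c hc => hc.2⟩
  choose K hK using hbound
  set k := (Finset.range (P.natDegree + 1)).sup K + 1
  have hall : ∀ᶠ c : ℂ in cobounded ℂ, ∀ i ∈ Finset.range (P.natDegree + 1),
      ‖eval (logVec c) (P.coeff i)‖ ≤ ‖c‖ ^ K i :=
    (Finset.eventually_all _).2 fun i _ => hK i
  obtain ⟨_, hl⟩ := exists_eventually_norm_eval_logVec (Polynomial.leadingCoeff_ne_zero.2 hP)
  obtain ⟨_, h0⟩ := exists_eventually_norm_eval_logVec h0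
  have hz : Tendsto (fun c : ℂ => ‖c‖) (cobounded ℂ) atTop := tendsto_norm_cobounded_atTop
  refine ⟨(2 * k + 1 : ℕ) + 1, ?_⟩
  filter_upwards [hall, hl, h0, hz.eventually_ge_atTop 2,
    (Real.tendsto_log_atTop.comp hz).eventually_ge_atTop Real.pi] with c h1 h2 h3 h4 h5 W hW
  have hB : 1 ≤ ‖c‖ ^ k := one_le_pow₀ (by linarith)
  have hinv : (‖c‖ ^ k)⁻¹ ≤ ‖c‖⁻¹ := by
    gcongr
    exact le_self_pow₀ (by linarith) (by omega)
  have hlead : eval (logVec c) P.leadingCoeff ≠ 0 := by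
    have : 0 < ‖eval (logVec c) P.leadingCoeff‖ := lt_of_lt_of_le (by positivity) h2.1
    exact norm_pos_iff.1 this
  have hcoeff : ∀ i, ‖(P.map (eval (logVec c))).coeff i‖ ≤ ‖c‖ ^ k := by
    intro i
    rw [Polynomial.coeff_map]
    by_cases hi : i ≤ P.natDegree
    · have hi' : i ∈ Finset.range (P.natDegree + 1) := Finset.mem_range.2 (by omega)
      refine (h1 i hi').trans (pow_le_pow_right₀ (by linarith) ?_)
      exact (Finset.le_sup hi').trans (Nat.le_succ _)
    · rw [Polynomial.coeff_eq_zero_of_natDegree_lt (by omega), map_zero, norm_zero]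
      positivity
  obtain ⟨hW0, hlog⟩ := Polynomial.abs_log_norm_le_of_isRoot hB hcoeff
    (by rw [Polynomial.leadingCoeff_map_of_leadingCoeff_ne_zero _ hlead]; exact hinv.trans h2.1)
    (by rw [Polynomial.coeff_map]; exact hinv.trans h3.1) hW
  refine ⟨hW0, ?_⟩
  refine (Complex.norm_le_abs_re_add_abs_im _).trans ?_
  rw [Complex.log_re, Complex.log_im, add_one_mul]
  refine add_le_add (hlog.trans ?_) ((Complex.abs_arg_le_pi _).trans h5)
  rw [← Real.log_pow]
  refine Real.log_le_log (by positivity) ?_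
  have : 1 ≤ (‖c‖ ^ k) ^ 2 := one_le_pow₀ hB
  calc (‖c‖ ^ k) ^ 2 + 1 ≤ (‖c‖ ^ k) ^ 2 * 2 := by linarith
    _ ≤ (‖c‖ ^ k) ^ 2 * ‖c‖ := by gcongr
    _ = ‖c‖ ^ (2 * k + 1) := by ring

open Filter Topology in
theorem exists_ball_eval_exp_ne_zero {Q : Polynomial ℂ} (hQ : Q ≠ 0) :
    ∃ r : ℝ, 0 < r ∧ r ≤ 1 ∧ ∀ ζ : ℂ, ζ ≠ 0 → ‖ζ‖ ≤ r → Q.eval (Complex.exp ζ) ≠ 0 := by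
  have h1 : ∀ᶠ w in 𝓝[≠] (Complex.exp 0), Q.eval w ≠ 0 := by
    have : ∀ᶠ w in 𝓝[≠] (Complex.exp 0), w ∉ (Q.rootSet ℂ \ {Complex.exp 0}) := by
      have hf : (Q.rootSet ℂ \ {Complex.exp 0}).Finite := (Q.rootSet_finite ℂ).sdiff
      exact eventually_nhdsWithin_of_eventually_nhds (hf.isClosed.isOpen_compl.mem_nhds (by simp))
    filter_upwards [this, self_mem_nhdsWithin] with w hw hw' h
    exact hw ⟨by simpa [Polynomial.mem_rootSet, hQ] using h, hw'⟩
  have h2 := ((Complex.hasDerivAt_exp 0).tendsto_nhdsNE (Complex.exp_ne_zero 0)).eventually h1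
  rw [eventually_nhdsWithin_iff, Metric.eventually_nhds_iff] at h2
  obtain ⟨ε, hε, h⟩ := h2
  refine ⟨min (ε / 2) 1, by positivity, min_le_right _ _, fun ζ hζ hζr => h ?_ hζ⟩
  rw [dist_zero_right]
  linarith [hζr.trans (min_le_left _ _)]

theorem exists_zero_of_norm_lt {f : ℂ → ℂ} {r δ : ℝ} (hr : 0 < r)
    (hf : DifferentiableOn ℂ f (Metric.closedBall 0 r)) (h0 : ‖f 0‖ < δ)
    (hδ : ∀ z, ‖z‖ = r → δ ≤ ‖f z‖) : ∃ z, ‖z‖ ≤ r ∧ f z = 0 := by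
  by_contra! hne
  have hδ0 : 0 < δ := (norm_nonneg _).trans_lt h0
  have hcl : closure (Metric.ball (0 : ℂ) r) = Metric.closedBall 0 r := closure_ball 0 hr.ne'
  have hd : DiffContOnCl ℂ (fun z => (f z)⁻¹) (Metric.ball 0 r) := by
    refine DifferentiableOn.diffContOnCl ?_
    rw [hcl]
    exact hf.inv fun z hz => hne z (by simpa using hz)
  have := Complex.norm_le_of_forall_mem_frontier_norm_le Metric.isBounded_ball hd
    (C := δ⁻¹) (fun z hz => ?_) (z := 0) (subset_closure (by simpa using hr))
  · rw [norm_inv, inv_le_inv₀ (norm_pos_iff.2 (hne 0 (by simpa using hr.le))) hδ0] at this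
    linarith
  · rw [frontier_ball 0 hr.ne', mem_sphere_zero_iff_norm] at hz
    rw [norm_inv]
    gcongr
    exact hδ z hz

open Filter Topology in
theorem exists_limit_of_sum_eq_zero {D : ℕ} {T : ℕ → Fin (D + 1) → ℂ}
    (hT : ∀ᶠ n in atTop, T n ≠ 0 ∧ ∑ i, T n i = 0) :
    ∃ (A : Fin (D + 1) → ℂ) (φ : ℕ → ℕ), A ≠ 0 ∧ ∑ i, A i = 0 ∧ StrictMono φ ∧
      ∀ i, Tendsto (fun n => T (φ n) i / ‖T (φ n)‖) atTop (𝓝 (A i)) := by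
  let t : ℕ → Fin (D + 1) → ℂ := fun n i => T n i / ‖T n‖
  have ht : ∀ n, t n = ((‖T n‖ : ℂ)⁻¹) • T n := by
    intro n
    ext i
    simp [t, div_eq_inv_mul]
  have hs : ∀ᶠ n in atTop, t n ∈ Metric.sphere (0 : Fin (D + 1) → ℂ) 1 := by
    filter_upwards [hT] with n hn
    rw [mem_sphere_zero_iff_norm, ht, norm_smul, norm_inv, Complex.norm_real, norm_norm,
      inv_mul_cancel₀ (norm_ne_zero_iff.2 hn.1)]
  obtain ⟨A, hA, φ, hφ, hlim⟩ := (isCompact_sphere _ _).tendsto_subseq' hs.frequently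
  rw [tendsto_pi_nhds] at hlim
  refine ⟨A, φ, ?_, ?_, hφ, hlim⟩
  · rintro rfl
    simp at hA
  · have h1 : Tendsto (fun n => ∑ i, t (φ n) i) atTop (𝓝 (∑ i, A i)) :=
      tendsto_finsetSum _ fun i _ => hlim i
    refine tendsto_nhds_unique (h1.congr' ?_) tendsto_const_nhds
    filter_upwards [hφ.tendsto_atTop.eventually hT] with n hn
    simp only [t]
    rw [← Finset.sum_div, hn.2, zero_div]

theorem differentiableAt_eval_logVec {c : ℂ} (hc : 0 < c.im) (hc' : 1 < ‖c‖)
    (q : MvPolynomial (Fin 3) ℂ) : DifferentiableAt ℂ (fun z => eval (logVec z) q) c := by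
  have h1 : DifferentiableAt ℂ Complex.log c :=
    differentiableAt_id.clog (Or.inr hc.ne')
  have h2 : DifferentiableAt ℂ (fun z => Complex.log (Complex.log z)) c := by
    refine h1.clog (Or.inl ?_)
    rw [Complex.log_re]
    exact Real.log_pos hc'
  simp only [MvPolynomial.eval_eq', logVec, Fin.prod_univ_three]
  refine DifferentiableAt.fun_sum fun m _ => ?_
  refine (differentiableAt_const _).mul (((h2.pow _).mul (h1.pow _)).mul (differentiableAt_id.pow _))

open Filter Topology Bornology in
theorem frequently_eval_exp_eq_zero {P : Polynomial (MvPolynomial (Fin 3) ℂ)}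
    (hdeg : 0 < P.natDegree) (h0 : P.coeff 0 ≠ 0) :
    ∃ᶠ c : ℂ in cobounded ℂ,
      ‖c‖ / 2 ≤ c.im ∧ (P.map (eval (logVec c))).eval (Complex.exp c) = 0 := by
  intro hno
  have hP : P ≠ 0 := by
    rintro rfl
    simp at h0
  set D := P.natDegree with hDdef
  let c : ℕ → ℂ := fun n => n * (2 * Real.pi * Complex.I)
  have hcn : ∀ n, ‖c n‖ = n * (2 * Real.pi) := by
    intro n
    simp [c, abs_of_pos Real.pi_pos]
  have hc : Tendsto c atTop (cobounded ℂ) := by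
    rw [← tendsto_norm_atTop_iff_cobounded]
    simp only [hcn]
    exact tendsto_natCast_atTop_atTop.atTop_mul_const (by positivity)
  have hexp : ∀ n, Complex.exp (c n) = 1 := fun n => Complex.exp_nat_mul_two_pi_mul_I n
  have hlead : ∀ᶠ n in atTop, eval (logVec (c n)) P.leadingCoeff ≠ 0 :=
    hc.eventually (eventually_eval_logVec_ne_zero (Polynomial.leadingCoeff_ne_zero.2 hP))
  have hconst : ∀ᶠ n in atTop, eval (logVec (c n)) (P.coeff 0) ≠ 0 :=
    hc.eventually (eventually_eval_logVec_ne_zero h0)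
  have hroot : ∀ n, ∃ W : ℂ, eval (logVec (c n)) P.leadingCoeff ≠ 0 →
      (P.map (eval (logVec (c n)))).IsRoot W := by
    intro n
    by_cases h : eval (logVec (c n)) P.leadingCoeff = 0
    · exact ⟨0, fun h' => absurd h h'⟩
    · obtain ⟨W, hW⟩ := IsAlgClosed.exists_root (P.map (eval (logVec (c n)))) (by
        rw [Polynomial.degree_map_eq_of_leadingCoeff_ne_zero _ h]
        exact (Polynomial.natDegree_pos_iff_degree_pos.1 hdeg).ne')
      exact ⟨W, fun _ => hW⟩
  choose W hW using hroot
  obtain ⟨K, hK⟩ := exists_eventually_norm_log_root_le h0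
  have hWK : ∀ᶠ n in atTop, W n ≠ 0 ∧ ‖Complex.log (W n)‖ ≤ K * Real.log ‖c n‖ := by
    filter_upwards [hlead, hc.eventually hK] with n hn hn'
    exact hn' _ (hW n hn)
  let T : ℕ → Fin (D + 1) → ℂ := fun n i => eval (logVec (c n)) (P.coeff i) * W n ^ (i : ℕ)
  have hT : ∀ᶠ n in atTop, T n ≠ 0 ∧ ∑ i, T n i = 0 := by
    filter_upwards [hlead, hconst] with n hn hn'
    refine ⟨fun h => hn' (by simpa [T] using congrFun h 0), ?_⟩
    have := hW n hn
    rw [Polynomial.IsRoot, Polynomial.eval_map, Polynomial.eval₂_eq_sum_range,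
      ← Fin.sum_univ_eq_sum_range (fun i => eval (logVec (c n)) (P.coeff i) * W n ^ i)] at this
    exact this
  obtain ⟨A, φ, hA0, hAsum, hφ, hlim⟩ := exists_limit_of_sum_eq_zero hT
  let Q : Polynomial ℂ := ∑ i : Fin (D + 1), Polynomial.C (A i) * Polynomial.X ^ (i : ℕ)
  have hQeval : ∀ w, Q.eval w = ∑ i, A i * w ^ (i : ℕ) := by
    intro w
    simp [Q, Polynomial.eval_finsetSum]
  have hQ0 : Q ≠ 0 := by
    intro h
    apply hA0
    ext i
    have := congrArg (Polynomial.coeff · (i : ℕ)) h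
    simpa [Q, Polynomial.finsetSum_coeff, Polynomial.coeff_C_mul_X_pow, Fin.val_inj] using this
  obtain ⟨r, hr0, hr1, hr⟩ := exists_ball_eval_exp_ne_zero hQ0
  obtain ⟨z₀, hz₀, hmin⟩ := (isCompact_sphere (0 : ℂ) r).exists_isMinOn
    (NormedSpace.sphere_nonempty.2 hr0.le)
    (f := fun ζ => ‖Q.eval (Complex.exp ζ)‖) (by fun_prop)
  rw [mem_sphere_zero_iff_norm] at hz₀
  set m := ‖Q.eval (Complex.exp z₀)‖ with hm
  have hm0 : 0 < m := norm_pos_iff.2 (hr z₀ (norm_pos_iff.1 (hz₀ ▸ hr0)) hz₀.le)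
  let l : Filter (ℕ × ℂ) := atTop ×ˢ 𝓟 (Metric.closedBall 0 1)
  let s : ℕ × ℂ → ℂ := fun x => c (φ x.1) + Complex.log (W (φ x.1)) + x.2
  have hφl : Tendsto (fun x : ℕ × ℂ => φ x.1) l atTop := hφ.tendsto_atTop.comp tendsto_fst
  have hcl : Tendsto (fun x : ℕ × ℂ => c (φ x.1)) l (cobounded ℂ) := hc.comp hφl
  have hball : ∀ᶠ x in l, ‖x.2‖ ≤ 1 := by
    have : ∀ᶠ z in 𝓟 (Metric.closedBall (0 : ℂ) 1), ‖z‖ ≤ 1 := by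
      rw [eventually_principal]
      intro z hz
      simpa using hz
    exact tendsto_snd.eventually this
  have hcl' : Tendsto (fun x : ℕ × ℂ => ‖c (φ x.1)‖) l atTop :=
    tendsto_norm_cobounded_atTop.comp hcl
  have hsc : Tendsto (fun x => s x / c (φ x.1)) l (𝓝 1) := by
    have h1 : Tendsto (fun x => (s x - c (φ x.1)) / c (φ x.1)) l (𝓝 0) := by
      rw [tendsto_zero_iff_norm_tendsto_zero]
      have h2 : Tendsto (fun x : ℝ => K * (Real.log x / x) + 1 / x) atTop (𝓝 0) := by
        have := (Real.isLittleO_log_id_atTop).tendsto_div_nhds_zero.const_mul K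
        simpa using this.add (tendsto_const_nhds (x := (1 : ℝ)).div_atTop tendsto_id)
      refine squeeze_zero' (Eventually.of_forall fun x => norm_nonneg _) ?_ (h2.comp hcl')
      filter_upwards [hφl.eventually hWK, hball] with x hx hx'
      simp only [s, Function.comp]
      rw [norm_div, add_assoc, add_sub_cancel_left, ← mul_div_assoc, ← add_div]
      gcongr
      exact (norm_add_le _ _).trans (add_le_add hx.2 hx')
    have h3 := h1.add_const 1
    rw [zero_add] at h3
    refine h3.congr' ?_
    filter_upwards [hcl.eventually (eventually_ne_cobounded 0)] with x hx
    rw [sub_div, div_self hx, sub_add_cancel]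
  have hs : Tendsto s l (cobounded ℂ) := tendsto_cobounded_of_div hcl hsc
  have him : ∀ᶠ x in l, ‖s x‖ / 2 ≤ (s x).im := by
    filter_upwards [(tendsto_iff_norm_sub_tendsto_zero.1 hsc).eventually_le_const
      (by norm_num : (0 : ℝ) < 1 / 4), hcl.eventually (eventually_ne_cobounded 0)] with x hx hx0
    rw [div_sub_one hx0, norm_div, div_le_iff₀ (norm_pos_iff.2 hx0)] at hx
    have h1 := (Complex.abs_im_le_norm _).trans hx
    have h2 : (c (φ x.1)).im = ‖c (φ x.1)‖ := by
      rw [hcn]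
      simp [c]
    rw [Complex.sub_im, h2, abs_le] at h1
    have h3 := norm_sub_norm_le (s x) (c (φ x.1))
    linarith
  let G : ℕ × ℂ → ℂ := fun x =>
    (∑ i : Fin (D + 1), eval (logVec (s x)) (P.coeff i) * (W (φ x.1) * Complex.exp x.2) ^ (i : ℕ))
      / ‖T (φ x.1)‖
  have hG : Tendsto (fun x => G x - Q.eval (Complex.exp x.2)) l (𝓝 0) := by
    have hterm : ∀ i : Fin (D + 1), Tendsto (fun x : ℕ × ℂ =>
        (eval (logVec (s x)) (P.coeff i) * W (φ x.1) ^ (i : ℕ) / ‖T (φ x.1)‖ - A i) *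
          Complex.exp x.2 ^ (i : ℕ)) l (𝓝 0) := by
      intro i
      refine Tendsto.zero_mul_isBoundedUnder_le ?_ ?_
      · have h1 : Tendsto (fun x : ℕ × ℂ => T (φ x.1) i / ‖T (φ x.1)‖) l (𝓝 (A i)) :=
          (hlim i).comp tendsto_fst
        by_cases hi : P.coeff i = 0
        · simpa [T, hi] using h1.sub_const (A i)
        · have h2 := ((tendsto_eval_logVec_div hcl hsc hi).mul h1).sub_const (A i)
          rw [one_mul, sub_self] at h2
          refine h2.congr' ?_
          filter_upwards [hcl.eventually (eventually_eval_logVec_ne_zero hi)] with x hx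
          simp only [T]
          field_simp
      · refine isBoundedUnder_of_eventually_le (a := Real.exp 1 ^ (i : ℕ)) ?_
        filter_upwards [hball] with x hx
        simp only [Function.comp]
        rw [norm_pow]
        gcongr
        rw [Complex.norm_exp]
        exact Real.exp_le_exp.2 ((Complex.re_le_norm _).trans hx)
    have := tendsto_finsetSum Finset.univ fun i _ => hterm i
    rw [Finset.sum_const_zero] at this
    refine this.congr fun x => ?_
    simp only [G]
    rw [hQeval, Finset.sum_div, ← Finset.sum_sub_distrib]
    refine Finset.sum_congr rfl fun i _ => ?_
    rw [mul_pow]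
    ring
  have hev : ∀ᶠ x in l, ‖G x - Q.eval (Complex.exp x.2)‖ < m / 4 ∧ ‖s x‖ / 2 ≤ (s x).im ∧
      1 < ‖s x‖ ∧ ¬ (‖s x‖ / 2 ≤ (s x).im ∧
        (P.map (eval (logVec (s x)))).eval (Complex.exp (s x)) = 0) := by
    filter_upwards [hG.norm.eventually_lt_const (by simpa using hm0 : ‖(0 : ℂ)‖ < m / 4), him,
      (tendsto_norm_cobounded_atTop.comp hs).eventually_gt_atTop 1, hs.eventually hno]
      with x h1 h2 h3 h4 using ⟨h1, h2, h3, h4⟩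
  rw [eventually_prod_principal_iff] at hev
  obtain ⟨n, hn, ⟨hTn, -⟩, hWn, -⟩ :=
    (hev.and (hφ.tendsto_atTop.eventually (hT.and hWK))).exists
  have hle : ∀ ζ : ℂ, ‖ζ‖ ≤ r → ζ ∈ Metric.closedBall (0 : ℂ) 1 := fun ζ hζ => by
    simpa using hζ.trans hr1
  have hdiff : DifferentiableOn ℂ (fun ζ => G (n, ζ)) (Metric.closedBall 0 r) := by
    intro ζ hζ
    have h := hn ζ (hle ζ (by simpa using hζ))
    have hterm : ∀ i : Fin (D + 1), DifferentiableAt ℂ (fun ζ => eval (logVec (s (n, ζ)))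
        (P.coeff i) * (W (φ n) * Complex.exp ζ) ^ (i : ℕ)) ζ := by
      intro i
      have hsd : DifferentiableAt ℂ (fun ζ => s (n, ζ)) ζ := by
        simp only [s]
        fun_prop
      have him : 0 < (s (n, ζ)).im := by linarith [h.2.1, h.2.2.1]
      have hq : DifferentiableAt ℂ (fun ζ => eval (logVec (s (n, ζ))) (P.coeff i)) ζ :=
        DifferentiableAt.comp (g := fun z => eval (logVec z) (P.coeff i))
          (f := fun ζ => s (n, ζ)) ζ (differentiableAt_eval_logVec him h.2.2.1 _) hsd
      exact hq.mul (by fun_prop)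
    have hsum := (DifferentiableAt.fun_sum (u := Finset.univ) fun i _ => hterm i).div_const
      (‖T (φ n)‖ : ℂ)
    exact hsum.differentiableWithinAt
  have hcenter : ‖G (n, 0)‖ < m / 2 := by
    have h := (hn 0 (hle 0 (by simpa using hr0.le))).1
    rw [Complex.exp_zero, hQeval] at h
    simp only [one_pow, mul_one, hAsum, sub_zero] at h
    linarith
  have hbdry : ∀ ζ, ‖ζ‖ = r → m / 2 ≤ ‖G (n, ζ)‖ := by
    intro ζ hζ
    have h1 := (hn ζ (hle ζ hζ.le)).1
    have h2 : m ≤ ‖Q.eval (Complex.exp ζ)‖ := hmin (mem_sphere_zero_iff_norm.2 hζ)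
    have h3 := norm_sub_norm_le (Q.eval (Complex.exp ζ)) (G (n, ζ))
    rw [norm_sub_rev] at h3
    simp only at h1
    linarith
  obtain ⟨ζ, hζ, hζ0⟩ := exists_zero_of_norm_lt hr0 hdiff hcenter hbdry
  have h := hn ζ (hle ζ hζ)
  refine h.2.2.2 ⟨h.2.1, ?_⟩
  have hes : Complex.exp (s (n, ζ)) = W (φ n) * Complex.exp ζ := by
    simp only [s]
    rw [Complex.exp_add, Complex.exp_add, hexp, one_mul, Complex.exp_log hWn]
  rw [hes, Polynomial.eval_map, Polynomial.eval₂_eq_sum_range, ← Fin.sum_univ_eq_sum_range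
    (fun i => eval (logVec (s (n, ζ))) (P.coeff i) * (W (φ n) * Complex.exp ζ) ^ i)]
  have hTn' : (‖T (φ n)‖ : ℂ) ≠ 0 := by exact_mod_cast norm_ne_zero_iff.2 hTn
  exact (div_eq_zero_iff.1 hζ0).resolve_right hTn'

theorem real_coeff_eq_zero_of_arg_pos {b : ℂ} (hre : 0 < b.re) (him : 0 < b.im)
    (hlog : 1 < Real.log ‖b‖) {r s : ℝ} (h : (r : ℂ) * Complex.log b + s * b = 0) :
    r = 0 ∧ s = 0 := by
  have h1 := congrArg Complex.re h
  have h2 := congrArg Complex.im h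
  simp only [Complex.add_re, Complex.add_im, Complex.re_ofReal_mul, Complex.im_ofReal_mul,
    Complex.log_re, Complex.log_im, Complex.zero_re, Complex.zero_im] at h1 h2
  have harg : b.arg * b.re ≤ b.im := by
    have h0 : 0 ≤ b.arg := Complex.arg_nonneg_iff.2 him.le
    have h3 : b.arg < Real.pi / 2 := (abs_lt.1 (Complex.abs_arg_lt_pi_div_two_iff.2 (Or.inl hre))).2
    have h4 := Real.le_tan h0 h3
    rwa [Complex.tan_arg, le_div_iff₀ hre] at h4
  have hdet : 0 < b.im * Real.log ‖b‖ - b.re * b.arg := by nlinarith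
  have hr : r * (b.im * Real.log ‖b‖ - b.re * b.arg) = 0 := by
    linear_combination b.im * h1 - b.re * h2
  have hr0 : r = 0 := (mul_eq_zero.1 hr).resolve_right hdet.ne'
  rw [hr0, zero_mul, zero_add] at h2
  exact ⟨hr0, (mul_eq_zero.1 h2).resolve_right him.ne'⟩

open Filter Topology Bornology in
theorem eventually_real_coeff_eq_zero :
    ∀ᶠ c : ℂ in cobounded ℂ, 0 < c.im → ∀ r s : ℝ,
      (r : ℂ) * Complex.log (Complex.log c) + s * Complex.log c = 0 → r = 0 ∧ s = 0 := by
  filter_upwards [(Real.tendsto_log_atTop.comp tendsto_norm_cobounded_atTop).eventually_gt_atTop 0,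
    ((Real.tendsto_log_atTop.comp tendsto_norm_cobounded_atTop).comp
      tendsto_log_cobounded).eventually_gt_atTop 1] with c h1 h2 him r s h
  refine real_coeff_eq_zero_of_arg_pos ?_ ?_ h2 h
  · rwa [Complex.log_re]
  · rw [Complex.log_im]
    refine (Complex.arg_nonneg_iff.2 him.le).lt_of_ne fun h0 => him.ne ?_
    exact (Complex.arg_eq_zero_iff.1 h0.symm).2.symm

open Filter Topology Bornology in
theorem eventually_lt_abs_real_coeff (E : ℝ) :
    ∀ᶠ c : ℂ in cobounded ℂ, ‖c‖ / 2 ≤ c.im → ∀ r s : ℝ,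
      c = r * Complex.log (Complex.log c) + s * Complex.log c → E < |r| := by
  have hsmall := ((tendsto_norm_log_pow_div 2).const_mul |E|).eventually_lt_const
    (by simp : |E| * 0 < 1)
  filter_upwards [hsmall, eventually_logVec, eventually_ne_cobounded 0,
    (Real.tendsto_log_atTop.comp tendsto_norm_cobounded_atTop).eventually_ge_atTop
      (2 + 2 * Real.pi)] with c h1 h2 h0 h3 him r s h
  simp only [Function.comp] at h3
  have hc : 0 < ‖c‖ := norm_pos_iff.2 h0
  set b := Complex.log c with hb
  set a := Complex.log b with ha
  have hbre : b.re = Real.log ‖c‖ := Complex.log_re c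
  have hbim : |b.im| ≤ Real.pi := by
    rw [hb, Complex.log_im]
    exact Complex.abs_arg_le_pi c
  have hdet : c.im * b.re - c.re * b.im = r * (a.im * b.re - a.re * b.im) := by
    have hre := congrArg Complex.re h
    have him := congrArg Complex.im h
    simp only [Complex.add_re, Complex.add_im, Complex.re_ofReal_mul, Complex.im_ofReal_mul]
      at hre him
    linear_combination b.re * him - b.im * hre
  have hlow : ‖c‖ ≤ c.im * b.re - c.re * b.im := by
    have h4 : c.re * b.im ≤ ‖c‖ * Real.pi := by
      refine (le_abs_self _).trans ?_
      rw [abs_mul]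
      gcongr
      exact Complex.abs_re_le_norm c
    have h5 : ‖c‖ / 2 * (2 + 2 * Real.pi) ≤ c.im * b.re := by
      rw [hbre]
      have := Real.pi_pos
      exact mul_le_mul him h3 (by positivity) ((by positivity : 0 ≤ ‖c‖ / 2).trans him)
    nlinarith
  have hup : |a.im * b.re - a.re * b.im| ≤ ‖b‖ ^ 2 := by
    have h4 : a.im * b.re - a.re * b.im = (a * (starRingEnd ℂ) b).im := by
      simp
      ring
    rw [h4]
    refine (Complex.abs_im_le_norm _).trans ?_
    rw [norm_mul, Complex.norm_conj, sq]
    gcongr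
    exact h2.2.1
  rw [← mul_div_assoc, div_lt_one hc] at h1
  have h6 : ‖c‖ ≤ |r| * ‖b‖ ^ 2 := by
    rw [hdet] at hlow
    refine hlow.trans ((le_abs_self _).trans ?_)
    rw [abs_mul]
    gcongr
  exact (le_abs_self E).trans_lt (lt_of_mul_lt_mul_right (h1.trans_le h6) (by positivity))

/-- A polynomial in four variables, seen as a polynomial in the last one. -/
noncomputable def lastVarEquiv :
    MvPolynomial (Fin 4) ℂ ≃ₐ[ℂ] Polynomial (MvPolynomial (Fin 3) ℂ) :=
  (renameEquiv ℂ (finRotate 4)).trans (finSuccEquiv ℂ 3)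

theorem eval_map_lastVarEquiv (p : MvPolynomial (Fin 4) ℂ) (a b c d : ℂ) :
    ((lastVarEquiv p).map (eval ![a, b, c])).eval d = eval ![a, b, c, d] p := by
  simp only [lastVarEquiv, AlgEquiv.trans_apply, renameEquiv_apply]
  rw [← eval_eq_eval_mv_eval', eval_rename]
  congr 2
  ext i
  fin_cases i <;> rfl

theorem natDegree_lastVarEquiv (p : MvPolynomial (Fin 4) ℂ) :
    (lastVarEquiv p).natDegree = degreeOf 3 p := by
  simp only [lastVarEquiv, AlgEquiv.trans_apply, renameEquiv_apply]
  rw [natDegree_finSuccEquiv, show (0 : Fin 4) = finRotate 4 3 from rfl,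
    degreeOf_rename_of_injective (finRotate 4).injective]

theorem isAlgebraic_coeff_lastVarEquiv {p : MvPolynomial (Fin 4) ℂ}
    (hp : ∀ m, IsAlgebraic ℚ (coeff m p)) (i : ℕ) (m : Fin 3 →₀ ℕ) :
    IsAlgebraic ℚ (coeff m ((lastVarEquiv p).coeff i)) := by
  simp only [lastVarEquiv, AlgEquiv.trans_apply, renameEquiv_apply]
  rw [finSuccEquiv_coeff_coeff]
  by_contra h
  have h0 : coeff (m.cons i) (rename (finRotate 4) p) ≠ 0 := by
    intro h0
    exact h (h0 ▸ isAlgebraic_zero)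
  obtain ⟨u, hu, -⟩ := coeff_rename_ne_zero _ _ _ h0
  rw [← hu, coeff_rename_mapDomain _ (finRotate 4).injective] at h
  exact h (hp u)

theorem coeff_zero_lastVarEquiv_ne_zero {p : MvPolynomial (Fin 4) ℂ} (hirr : Irreducible p)
    (hx : degreeOf 0 p ≠ 0) : (lastVarEquiv p).coeff 0 ≠ 0 := by
  have hX : lastVarEquiv (X 3) = Polynomial.X := by
    simp only [lastVarEquiv, AlgEquiv.trans_apply, renameEquiv_apply, rename_X]
    exact finSuccEquiv_X_zero
  intro h0
  obtain ⟨Q, hQ⟩ := Polynomial.X_dvd_iff.2 h0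
  have hp : p = X 3 * lastVarEquiv.symm Q := by
    apply lastVarEquiv.injective
    rw [map_mul, hX, hQ, AlgEquiv.apply_symm_apply]
  have h3 : ¬ IsUnit (X 3 : MvPolynomial (Fin 4) ℂ) := X_prime.not_isUnit
  obtain ⟨u, -, hu⟩ := MvPolynomial.isUnit_iff_eq_C_of_isReduced.1
    ((hirr.isUnit_or_isUnit hp).resolve_left h3)
  rw [hu, mul_comm] at hp
  refine hx (Nat.le_zero.1 ?_)
  rw [hp]
  refine (degreeOf_C_mul_le _ _ _).trans ?_
  rw [degreeOf_X, if_neg (by decide)]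

theorem exists_totalDegree_coeff_le (P : Polynomial (MvPolynomial (Fin 3) ℂ)) :
    ∃ E : ℕ, ∀ i, (P.coeff i).totalDegree ≤ E := by
  refine ⟨P.support.sup fun i => (P.coeff i).totalDegree, fun i => ?_⟩
  by_cases hi : P.coeff i = 0
  · simp [hi]
  · exact Finset.le_sup (f := fun i => (P.coeff i).totalDegree) (Polynomial.mem_support_iff.2 hi)

/-- (SC) **Main result.** For a nonzero irreducible `p ∈ ℚ^alg[x,y,z,w]`
depending on `x` and the last variable `w`, there is `a ∈ ℂ` with
`p(a, e^a, e^{e^a}, e^{e^{e^a}}) = 0` which is generic: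
`td_ℚ(a, e^a, e^{e^a}, e^{e^{e^a}}) = 3`. -/
theorem generic_solution_three_iterations
    (hSC : SchanuelConjecture) (p : MvPolynomial (Fin 4) ℂ)
    (hcoeff : ∀ mo : Fin 4 →₀ ℕ, IsAlgebraic ℚ (MvPolynomial.coeff mo p))
    (hp0 : p ≠ 0) (hirr : Irreducible p)
    (hx : MvPolynomial.degreeOf 0 p ≠ 0) (hw : MvPolynomial.degreeOf 3 p ≠ 0) :
    ∃ a : ℂ,
      MvPolynomial.eval
        ![a, Complex.exp a, Complex.exp (Complex.exp a),
          Complex.exp (Complex.exp (Complex.exp a))] p = 0 ∧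
      HasTrdeg ({a, Complex.exp a, Complex.exp (Complex.exp a),
          Complex.exp (Complex.exp (Complex.exp a))} : Set ℂ) 3 := by
  have hdeg : 0 < (lastVarEquiv p).natDegree := by
    rw [natDegree_lastVarEquiv]
    exact Nat.pos_of_ne_zero hw
  have h0 := coeff_zero_lastVarEquiv_ne_zero hirr hx
  have hlead : (lastVarEquiv p).leadingCoeff ≠ 0 := by
    rw [Polynomial.leadingCoeff_ne_zero]
    exact (map_ne_zero_iff _ lastVarEquiv.injective).2 hp0
  have halg := isAlgebraic_coeff_lastVarEquiv hcoeff
  obtain ⟨E, hE⟩ := exists_totalDegree_coeff_le (lastVarEquiv p)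
  obtain ⟨c, ⟨hcim, hroot⟩, hc1, hc2, hc3, hc4, hc5, hc6⟩ :=
    ((frequently_eval_exp_eq_zero hdeg h0).and_eventually
      ((eventually_eval_logVec_ne_zero h0).and <| (eventually_eval_logVec_ne_zero hlead).and <|
        eventually_real_coeff_eq_zero.and <| (eventually_lt_abs_real_coeff E).and <|
        (Bornology.eventually_ne_cobounded 0).and eventually_logVec)).exists
  have hb0 : Complex.log c ≠ 0 :=
    norm_pos_iff.1 (one_pos.trans_le (hc6.1.trans hc6.2.1))
  have hb := Complex.exp_log hb0
  have hc := Complex.exp_log hc5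
  have him : 0 < c.im := (half_pos (norm_pos_iff.2 hc5)).trans_le hcim
  refine ⟨Complex.log (Complex.log c), ?_, ?_⟩
  · rw [hb, hc, ← eval_map_lastVarEquiv]
    exact hroot
  · rw [hb, hc]
    exact hasTrdeg_of_linearIndependent hSC halg hb.symm hc.symm rfl hroot hc2
      (linearIndependent_of_real_bound hSC halg hE hb.symm hc.symm hroot hc1 hc2
        (hc3 him) (hc4 hcim))
end
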